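/- arXiv:1711.01390 — 2 statements merged into one kernel-verified Lean document; each statement's English description precedes it below -/
import Mathlib

section
/- Under the stated hypotheses (Hessian determinant bounds and ∇f a diffeomorphism onto its image), one application of the bootstrap yields: N_S^w(Q,δ) ≪ δ Q^n + Q^{n−1+2/(n+1)} for all Q ≥ 2 and δ ∈ (0,1/2), with the implied constant depending only on f and w. -/
open MeasureTheory

/-- Distance from a real number to the nearest integer. -/
noncomputable def nint (θ : ℝ) : ℝ := |θ - round θ|

/-- Gradient of `f` at `x`. -/
noncomputable def gradv {m : ℕ} (f : (Fin m → ℝ) → ℝ) (x : Fin m → ℝ) : Fin m → ℝ :=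
  fun i => fderiv ℝ f x (Pi.single i 1)

/-- Hessian matrix of `f` at `x`. -/
noncomputable def hess {m : ℕ} (f : (Fin m → ℝ) → ℝ) (x : Fin m → ℝ) :
    Matrix (Fin m) (Fin m) ℝ :=
  Matrix.of fun i j => fderiv ℝ (fun y => fderiv ℝ f y (Pi.single j 1)) x (Pi.single i 1)

/-- The weighted counting function
`N_S^w(Q,δ) = ∑_{a ∈ ℤ^{m}, q ∈ ℤ, 1 ≤ q ≤ Q, ‖q f(a/q)‖ < δ} w(a/q)`. -/
noncomputable def NSw {m : ℕ} (f w : (Fin m → ℝ) → ℝ) (Q δ : ℝ) : ℝ :=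
  ∑ᶠ (q : ℤ) (a : Fin m → ℤ),
    if 1 ≤ q ∧ (q : ℝ) ≤ Q ∧ nint ((q : ℝ) * f (fun i => (a i : ℝ) / (q : ℝ))) < δ
      then w (fun i => (a i : ℝ) / (q : ℝ)) else 0

/-- The unimodular number `exp (i x)`. -/
noncomputable def unitExp (x : ℝ) : ℂ := Complex.exp (Complex.I * x)

lemma unitExp_add (x y : ℝ) : unitExp (x + y) = unitExp x * unitExp y := by
  simp [unitExp, mul_add, Complex.exp_add]

lemma norm_unitExp (x : ℝ) : ‖unitExp x‖ = 1 := by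
  rw [unitExp, mul_comm, Complex.norm_exp_ofReal_mul_I]

lemma conj_unitExp (x : ℝ) : (starRingEnd ℂ) (unitExp x) = unitExp (-x) := by
  rw [unitExp, ← Complex.exp_conj, unitExp]
  simp

lemma norm_unitExp_sub_one_le (x : ℝ) : ‖unitExp x - 1‖ ≤ |x| := by
  simpa [unitExp] using Real.norm_exp_I_mul_ofReal_sub_one_le (x := x)

lemma norm_unitExp_sub_one_ge {x : ℝ} (hx : |x| ≤ 1 / 2) : |x| / 2 ≤ ‖unitExp x - 1‖ := by
  have hpi := Real.pi_gt_three
  have hpi' := Real.pi_lt_four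
  rw [unitExp, Complex.norm_exp_I_mul_ofReal_sub_one, norm_mul, Real.norm_eq_abs, Real.norm_eq_abs,
    abs_two]
  have h1 : |x / 2| ≤ Real.pi / 2 := by
    rw [abs_div, abs_two]; linarith
  have h2 := Real.mul_abs_le_abs_sin h1
  rw [abs_div, abs_two] at h2
  have h3 : 1 / 2 ≤ 2 / Real.pi := by
    rw [div_le_div_iff₀ (by norm_num) (by linarith)]; linarith
  have h4 : 1 / 2 * (|x| / 2) ≤ 2 / Real.pi * (|x| / 2) :=
    mul_le_mul_of_nonneg_right h3 (by positivity)
  linarith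

lemma norm_unitExp_sub_one_sub_le {x : ℝ} (hx : |x| ≤ 1) :
    ‖unitExp x - 1 - Complex.I * x‖ ≤ |x| ^ 2 := by
  have := Complex.norm_exp_sub_one_sub_id_le (x := Complex.I * x) (by simpa using hx)
  simpa [unitExp] using this

/-- Second-order bounds for the reciprocals of `exp (i d) - 1` along three consecutive points. -/
lemma exists_inv_unitExp_sub_one_bounds {c C : ℝ} (hc : 0 < c) (hC : 0 < C) :
    ∃ K > (0 : ℝ), ∀ ρ η d₀ d₁ d₂ : ℝ, 0 < ρ → ρ ≤ 1 → 0 < η →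
      c * ρ ≤ |d₀| → c * ρ ≤ |d₁| → c * ρ ≤ |d₂| →
      |d₀| ≤ 1 / 2 → |d₁| ≤ 1 / 2 → |d₂| ≤ 1 / 2 →
      |d₀ - d₁| ≤ C * (η * ρ) → |d₁ - d₂| ≤ C * (η * ρ) →
      |d₀ - 2 * d₁ + d₂| ≤ C * (η ^ 2 * ρ) →
      (unitExp d₀ - 1 ≠ 0 ∧ unitExp d₁ - 1 ≠ 0 ∧ unitExp d₂ - 1 ≠ 0) ∧
      ‖(unitExp d₀ - 1)⁻¹‖ ≤ K / ρ ∧ ‖(unitExp d₁ - 1)⁻¹‖ ≤ K / ρ ∧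
      ‖(unitExp d₂ - 1)⁻¹‖ ≤ K / ρ ∧
      ‖(unitExp d₁ - 1)⁻¹ - (unitExp d₀ - 1)⁻¹‖ ≤ K * η / ρ ∧
      ‖(unitExp d₂ - 1)⁻¹ - (unitExp d₁ - 1)⁻¹‖ ≤ K * η / ρ ∧
      ‖(unitExp d₂ - 1)⁻¹ - 2 * (unitExp d₁ - 1)⁻¹ + (unitExp d₀ - 1)⁻¹‖ ≤ K * η ^ 2 / ρ := by
  set K₁ := 2 / c
  set K₂ := C * (2 / c) ^ 2
  set K₃ := (C + 2 * C ^ 2) * (2 / c) ^ 2 + 2 * C ^ 2 * (2 / c) ^ 3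
  have hK₁ : 0 < K₁ := by positivity
  have hK₂ : 0 < K₂ := by positivity
  have hK₃ : 0 < K₃ := by positivity
  refine ⟨K₁ + K₂ + K₃, by positivity, ?_⟩
  intro ρ η d₀ d₁ d₂ hρ hρ1 hη hc0 hc1 hc2 hd0 hd1 hd2 h01 h12 h012
  have low : ∀ d : ℝ, c * ρ ≤ |d| → |d| ≤ 1 / 2 →
      unitExp d - 1 ≠ 0 ∧ ‖(unitExp d - 1)⁻¹‖ ≤ 2 / c / ρ := by
    intro d h1 h2
    have h3 := norm_unitExp_sub_one_ge h2
    have h4 : 0 < c * ρ / 2 := by positivity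
    have h5 : c * ρ / 2 ≤ ‖unitExp d - 1‖ := by linarith
    refine ⟨norm_pos_iff.mp (by linarith), ?_⟩
    rw [norm_inv]
    calc ‖unitExp d - 1‖⁻¹ ≤ (c * ρ / 2)⁻¹ := inv_anti₀ h4 h5
      _ = 2 / c / ρ := by field_simp
  have diff : ∀ a b : ℝ, |a - b| ≤ C * (η * ρ) →
      ‖(unitExp a - 1) - (unitExp b - 1)‖ ≤ C * (η * ρ) := by
    intro a b h
    have : (unitExp a - 1) - (unitExp b - 1) = unitExp b * (unitExp (a - b) - 1) := by
      rw [mul_sub, ← unitExp_add]; ring_nf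
    rw [this, norm_mul, norm_unitExp, one_mul]
    exact (norm_unitExp_sub_one_le _).trans h
  obtain ⟨n0, l0⟩ := low d₀ hc0 hd0
  obtain ⟨n1, l1⟩ := low d₁ hc1 hd1
  obtain ⟨n2, l2⟩ := low d₂ hc2 hd2
  have x01 := diff _ _ h01
  have x12 := diff _ _ h12
  have second : ‖((unitExp d₀ - 1) - (unitExp d₁ - 1)) + ((unitExp d₂ - 1) - (unitExp d₁ - 1))‖
      ≤ (C + 2 * C ^ 2) * (η ^ 2 * ρ) := by
    have e : ((unitExp d₀ - 1) - (unitExp d₁ - 1)) + ((unitExp d₂ - 1) - (unitExp d₁ - 1))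
        = unitExp d₁ * ((unitExp (d₀ - d₁) - 1 - Complex.I * ((d₀ - d₁ : ℝ) : ℂ))
          + (unitExp (d₂ - d₁) - 1 - Complex.I * ((d₂ - d₁ : ℝ) : ℂ))
          + Complex.I * ((d₀ - 2 * d₁ + d₂ : ℝ) : ℂ)) := by
      have e0 : unitExp d₀ = unitExp d₁ * unitExp (d₀ - d₁) := by
        rw [← unitExp_add]; ring_nf
      have e2 : unitExp d₂ = unitExp d₁ * unitExp (d₂ - d₁) := by
        rw [← unitExp_add]; ring_nf
      rw [e0, e2]; push_cast; ring
    have b : ∀ a b : ℝ, |a| ≤ 1 / 2 → |b| ≤ 1 / 2 → |a - b| ≤ 1 := fun a b h1 h2 => by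
      have := abs_sub a b; linarith
    have s0 := norm_unitExp_sub_one_sub_le (b _ _ hd0 hd1)
    have s2 := norm_unitExp_sub_one_sub_le (b _ _ hd2 hd1)
    rw [abs_sub_comm] at h12
    have q0 : |d₀ - d₁| ^ 2 ≤ (C * (η * ρ)) ^ 2 := pow_le_pow_left₀ (abs_nonneg _) h01 2
    have q2 : |d₂ - d₁| ^ 2 ≤ (C * (η * ρ)) ^ 2 := pow_le_pow_left₀ (abs_nonneg _) h12 2
    rw [e, norm_mul, norm_unitExp, one_mul]
    refine (norm_add₃_le).trans ?_
    have s3 : ‖Complex.I * ((d₀ - 2 * d₁ + d₂ : ℝ) : ℂ)‖ ≤ C * (η ^ 2 * ρ) := by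
      rw [norm_mul, Complex.norm_I, one_mul, Complex.norm_real]; exact h012
    have : (C * (η * ρ)) ^ 2 ≤ C ^ 2 * (η ^ 2 * ρ) := by
      have : ρ ^ 2 ≤ ρ := by nlinarith
      calc (C * (η * ρ)) ^ 2 = C ^ 2 * (η ^ 2 * ρ ^ 2) := by ring
        _ ≤ _ := by gcongr
    linarith
  generalize unitExp d₀ - 1 = p₀ at *
  generalize unitExp d₁ - 1 = p₁ at *
  generalize unitExp d₂ - 1 = p₂ at *
  have mono : ∀ t : ℝ, 0 ≤ t → (K₁ * t ≤ (K₁ + K₂ + K₃) * t) ∧ (K₂ * t ≤ (K₁ + K₂ + K₃) * t) ∧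
      (K₃ * t ≤ (K₁ + K₂ + K₃) * t) := fun t ht =>
    ⟨by nlinarith [mul_nonneg hK₂.le ht, mul_nonneg hK₃.le ht],
      by nlinarith [mul_nonneg hK₁.le ht, mul_nonneg hK₃.le ht],
      by nlinarith [mul_nonneg hK₁.le ht, mul_nonneg hK₂.le ht]⟩
  have first : 2 / c / ρ ≤ (K₁ + K₂ + K₃) / ρ := by
    have := (mono (1 / ρ) (by positivity)).1
    simpa [K₁, div_eq_mul_inv] using this
  have firstdiff : ∀ a b : ℂ, a ≠ 0 → b ≠ 0 → ‖a⁻¹‖ ≤ 2 / c / ρ → ‖b⁻¹‖ ≤ 2 / c / ρ →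
      ‖a - b‖ ≤ C * (η * ρ) → ‖b⁻¹ - a⁻¹‖ ≤ (K₁ + K₂ + K₃) * η / ρ := by
    intro a b ha hb h1 h2 h3
    have : b⁻¹ - a⁻¹ = (a - b) * a⁻¹ * b⁻¹ := by field_simp
    rw [this, norm_mul, norm_mul]
    calc ‖a - b‖ * ‖a⁻¹‖ * ‖b⁻¹‖ ≤ (C * (η * ρ)) * (2 / c / ρ) * (2 / c / ρ) := by gcongr
      _ = K₂ * (η / ρ) := by simp only [K₂]; field_simp
      _ ≤ (K₁ + K₂ + K₃) * (η / ρ) := (mono _ (by positivity)).2.1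
      _ = _ := by ring
  refine ⟨⟨n0, n1, n2⟩, l0.trans first, l1.trans first, l2.trans first,
    firstdiff _ _ n0 n1 l0 l1 x01, firstdiff _ _ n1 n2 l1 l2 x12, ?_⟩
  have e : p₂⁻¹ - 2 * p₁⁻¹ + p₀⁻¹ =
      -(((p₀ - p₁) + (p₂ - p₁)) * p₀⁻¹ * p₂⁻¹) + 2 * ((p₀ - p₁) * (p₁ - p₂) * p₀⁻¹ * p₁⁻¹ * p₂⁻¹) := by
    field_simp; ring
  rw [e]
  refine (norm_add_le _ _).trans ?_
  rw [norm_neg]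
  simp only [norm_mul, Complex.norm_ofNat]
  calc ‖p₀ - p₁ + (p₂ - p₁)‖ * ‖p₀⁻¹‖ * ‖p₂⁻¹‖
        + 2 * (‖p₀ - p₁‖ * ‖p₁ - p₂‖ * ‖p₀⁻¹‖ * ‖p₁⁻¹‖ * ‖p₂⁻¹‖)
      ≤ ((C + 2 * C ^ 2) * (η ^ 2 * ρ)) * (2 / c / ρ) * (2 / c / ρ)
        + 2 * ((C * (η * ρ)) * (C * (η * ρ)) * (2 / c / ρ) * (2 / c / ρ) * (2 / c / ρ)) := by
        gcongr
    _ = K₃ * (η ^ 2 / ρ) := by simp only [K₃]; field_simp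
    _ ≤ (K₁ + K₂ + K₃) * (η ^ 2 / ρ) := (mono _ (by positivity)).2.2
    _ = _ := by ring

/-- Bound for the twice-iterated summation-by-parts coefficient. -/
lemma norm_iterated_parts_le {k₀ k₁ k₂ u₀ u₁ u₂ : ℂ} {K M η ρ : ℝ}
    (hK : 0 ≤ K) (hη : 0 < η) (hρ : 0 < ρ) (hk₁ : ‖k₁‖ ≤ K / ρ) (hk₂ : ‖k₂‖ ≤ K / ρ)
    (hk₀₁ : ‖k₁ - k₀‖ ≤ K * η / ρ) (hk₁₂ : ‖k₂ - k₁‖ ≤ K * η / ρ)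
    (hk : ‖k₂ - 2 * k₁ + k₀‖ ≤ K * η ^ 2 / ρ)
    (hu₀ : ‖u₀‖ ≤ M)
    (hu₀₁ : ‖u₁ - u₀‖ ≤ M * η)
    (hu : ‖u₂ - 2 * u₁ + u₀‖ ≤ M * η ^ 2) :
    ‖k₁ * (k₂ * u₂ - k₁ * u₁) - k₀ * (k₁ * u₁ - k₀ * u₀)‖
      ≤ 6 * M * K ^ 2 * (η / ρ) ^ 2 := by
  have e : k₁ * (k₂ * u₂ - k₁ * u₁) - k₀ * (k₁ * u₁ - k₀ * u₀) =
      k₁ * (k₂ * (u₂ - 2 * u₁ + u₀) + ((k₂ - k₁) * (u₁ - u₀) + (k₂ - k₁) * (u₁ - u₀))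
        + (k₂ - 2 * k₁ + k₀) * u₀)
      + (k₁ - k₀) * (k₁ * (u₁ - u₀) + (k₁ - k₀) * u₀) := by
    ring
  rw [e]
  have t1 : ‖k₂ * (u₂ - 2 * u₁ + u₀)‖ ≤ (K / ρ) * (M * η ^ 2) := by
    rw [norm_mul]; gcongr
  have t2 : ‖(k₂ - k₁) * (u₁ - u₀)‖ ≤ (K * η / ρ) * (M * η) := by
    rw [norm_mul]; gcongr
  have t3 : ‖(k₂ - 2 * k₁ + k₀) * u₀‖ ≤ (K * η ^ 2 / ρ) * M := by
    rw [norm_mul]; gcongr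
  have t4 : ‖k₁ * (u₁ - u₀)‖ ≤ (K / ρ) * (M * η) := by
    rw [norm_mul]; gcongr
  have t5 : ‖(k₁ - k₀) * u₀‖ ≤ (K * η / ρ) * M := by
    rw [norm_mul]; gcongr
  have s1 : ‖k₂ * (u₂ - 2 * u₁ + u₀) + ((k₂ - k₁) * (u₁ - u₀) + (k₂ - k₁) * (u₁ - u₀))
        + (k₂ - 2 * k₁ + k₀) * u₀‖ ≤ 4 * (K / ρ) * (M * η ^ 2) := by
    refine (norm_add₃_le).trans ?_
    have := norm_add_le ((k₂ - k₁) * (u₁ - u₀)) ((k₂ - k₁) * (u₁ - u₀))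
    calc _ ≤ (K / ρ) * (M * η ^ 2) + ((K * η / ρ) * (M * η) + (K * η / ρ) * (M * η))
          + (K * η ^ 2 / ρ) * M := by linarith
      _ = _ := by ring
  have s2 : ‖k₁ * (u₁ - u₀) + (k₁ - k₀) * u₀‖ ≤ 2 * (K / ρ) * (M * η) := by
    refine (norm_add_le _ _).trans ?_
    calc _ ≤ (K / ρ) * (M * η) + (K * η / ρ) * M := by linarith
      _ = _ := by ring
  refine (norm_add_le _ _).trans ?_
  rw [norm_mul, norm_mul]
  calc _ ≤ (K / ρ) * (4 * (K / ρ) * (M * η ^ 2)) + (K * η / ρ) * (2 * (K / ρ) * (M * η)) := by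
        gcongr
    _ = _ := by ring

/-- Summation by parts along a translation. -/
lemma tsum_mul_eq_of_translate {G : Type*} [AddCommGroup G] (E p v : G → ℂ) (e : G)
    (hv : v.HasFiniteSupport) (hE : ∀ a, E (a + e) - E a = E a * p a)
    (hp : ∀ a, v a ≠ 0 → p a ≠ 0) :
    ∑' a, v a * E a = ∑' a, ((p (a - e))⁻¹ * v (a - e) - (p a)⁻¹ * v a) * E a := by
  have hsupp : ∀ F : G → ℂ, (fun a => (p a)⁻¹ * v a * F a).HasFiniteSupport := fun F =>
    Set.Finite.subset hv fun a ha h => ha (by simp [h])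
  have h1 : ∑' a, v a * E a = ∑' a, ((p a)⁻¹ * v a * E (a + e) - (p a)⁻¹ * v a * E a) := by
    refine tsum_congr fun a => ?_
    rw [← mul_sub, hE]
    by_cases h : v a = 0
    · simp [h]
    · have := hp a h
      field_simp
  have hs1 := summable_of_hasFiniteSupport (L := .unconditional G) (hsupp fun a => E (a + e))
  have hs2 := summable_of_hasFiniteSupport (L := .unconditional G) (hsupp E)
  have hshift : ∑' a, (p a)⁻¹ * v a * E (a + e) = ∑' a, (p (a - e))⁻¹ * v (a - e) * E a := by
    rw [← (Equiv.subRight e).tsum_eq (fun a => (p a)⁻¹ * v a * E (a + e))]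
    simp
  have hs3 : Summable fun a => (p (a - e))⁻¹ * v (a - e) * E a := by
    have := (Equiv.subRight e).summable_iff.mpr hs1
    refine this.congr fun a => ?_
    simp
  rw [h1, hs1.tsum_sub hs2, hshift, ← hs3.tsum_sub hs2]
  exact tsum_congr fun a => by ring

/-- Summation by parts, twice, with a uniform bound on the resulting coefficients. -/
lemma norm_tsum_mul_le_of_translate {G : Type*} [AddCommGroup G] (E p v : G → ℂ) (e : G)
    (S : Finset G) (hv : v.HasFiniteSupport) (hE : ∀ a, E (a + e) - E a = E a * p a)
    (hE1 : ∀ a, ‖E a‖ = 1)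
    (hS : ∀ a, a ∉ S → v a = 0 ∧ v (a - e) = 0 ∧ v (a - e - e) = 0)
    (B : ℝ) (hB0 : 0 ≤ B)
    (hB : ∀ a, v a ≠ 0 ∨ v (a - e) ≠ 0 ∨ v (a - e - e) ≠ 0 → p a ≠ 0 ∧
      ‖(p (a - e))⁻¹ * ((p (a - e - e))⁻¹ * v (a - e - e) - (p (a - e))⁻¹ * v (a - e))
        - (p a)⁻¹ * ((p (a - e))⁻¹ * v (a - e) - (p a)⁻¹ * v a)‖ ≤ B) :
    ‖∑' a, v a * E a‖ ≤ S.card * B := by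
  rw [tsum_mul_eq_of_translate E p v e hv hE fun a ha => (hB a (Or.inl ha)).1]
  rw [tsum_mul_eq_of_translate E p (fun a => (p (a - e))⁻¹ * v (a - e) - (p a)⁻¹ * v a) e ?_ hE ?_]
  · rw [tsum_eq_sum (s := S)]
    · refine (norm_sum_le _ _).trans ?_
      rw [← nsmul_eq_mul]
      refine Finset.sum_le_card_nsmul _ _ _ fun a _ => ?_
      rw [norm_mul, hE1, mul_one]
      by_cases h : v a ≠ 0 ∨ v (a - e) ≠ 0 ∨ v (a - e - e) ≠ 0
      · exact (hB a h).2
      · push Not at h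
        simpa [h.1, h.2.1, h.2.2] using hB0
    · intro a ha
      obtain ⟨h1, h2, h3⟩ := hS a ha
      simp [h1, h2, h3]
  · refine Set.Finite.subset S.finite_toSet fun a ha => ?_
    by_contra h
    obtain ⟨h1, h2, -⟩ := hS a h
    exact ha (by simp [h1, h2])
  · intro a ha
    refine (hB a ?_).1
    by_contra! h
    exact ha (by simp [h.1, h.2.1])

/-- Van der Corput's inequality for finitely supported functions on an abelian group. -/
lemma card_mul_sq_norm_tsum_le {G : Type*} [AddCommGroup G] (φ : G → ℂ) (Hs P : Finset G)
    (hHs : Hs.Nonempty) (hP : ∀ h ∈ Hs, ∀ b, φ (b + h) ≠ 0 → b ∈ P) (β : G → ℝ) (R : ℝ)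
    (hβ : ∀ h ∈ Hs, ∀ h' ∈ Hs,
      ‖∑' a, φ (a + (h - h')) * (starRingEnd ℂ) (φ a)‖ ≤ β (h - h'))
    (hR : ∀ h' ∈ Hs, ∑ h ∈ Hs, β (h - h') ≤ R) :
    Hs.card * ‖∑' a, φ a‖ ^ 2 ≤ P.card * R := by
  have hsum : ∀ h ∈ Hs, ∑ b ∈ P, φ (b + h) = ∑' a, φ a := by
    intro h hh
    rw [← (Equiv.addRight h).tsum_eq φ, tsum_eq_sum (s := P)]
    · rfl
    · intro b hb
      by_contra h'
      exact hb (hP h hh b h')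
  have hcorr : ∀ h ∈ Hs, ∀ h' ∈ Hs,
      ‖∑ b ∈ P, φ (b + h) * (starRingEnd ℂ) (φ (b + h'))‖ ≤ β (h - h') := by
    intro h hh h' hh'
    refine le_of_eq_of_le ?_ (hβ h hh h' hh')
    rw [← (Equiv.addRight h').tsum_eq (fun a => φ (a + (h - h')) * (starRingEnd ℂ) (φ a)),
      tsum_eq_sum (s := P)]
    · simp [add_assoc]
    · intro b hb
      have : φ (b + h') = 0 := by
        by_contra h''
        exact hb (hP h' hh' b h'')
      simp [this]
  have hcard : (0 : ℝ) < Hs.card := by exact_mod_cast hHs.card_pos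
  have h1 : (Hs.card : ℂ) * ∑' a, φ a = ∑ b ∈ P, ∑ h ∈ Hs, φ (b + h) := by
    rw [Finset.sum_comm, Finset.sum_congr rfl hsum]
    simp
  have h2 : ∑ b ∈ P, ‖∑ h ∈ Hs, φ (b + h)‖ ^ 2 ≤ Hs.card * R := by
    have e : ((∑ b ∈ P, ‖∑ h ∈ Hs, φ (b + h)‖ ^ 2 : ℝ) : ℂ) =
        ∑ h' ∈ Hs, ∑ h ∈ Hs, ∑ b ∈ P, φ (b + h) * (starRingEnd ℂ) (φ (b + h')) := by
      push_cast
      have : ∀ b ∈ P, (‖∑ h ∈ Hs, φ (b + h)‖ : ℂ) ^ 2 =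
          ∑ h' ∈ Hs, ∑ h ∈ Hs, φ (b + h) * (starRingEnd ℂ) (φ (b + h')) := by
        intro b _
        rw [← Complex.mul_conj', map_sum, Finset.sum_mul_sum, Finset.sum_comm]
      rw [Finset.sum_congr rfl this, Finset.sum_comm]
      exact Finset.sum_congr rfl fun h' _ => Finset.sum_comm
    have hnn : 0 ≤ ∑ b ∈ P, ‖∑ h ∈ Hs, φ (b + h)‖ ^ 2 := Finset.sum_nonneg fun _ _ => by positivity
    rw [← Real.norm_of_nonneg hnn, ← Complex.norm_real, e, ← nsmul_eq_mul]
    refine (norm_sum_le _ _).trans (Finset.sum_le_card_nsmul _ _ _ fun h' hh' => ?_)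
    refine (norm_sum_le _ _).trans ((Finset.sum_le_sum fun h hh => ?_).trans (hR h' hh'))
    exact hcorr h hh h' hh'
  have h3 : ‖∑ b ∈ P, ∑ h ∈ Hs, φ (b + h)‖ ^ 2 ≤ P.card * ∑ b ∈ P, ‖∑ h ∈ Hs, φ (b + h)‖ ^ 2 :=
    (pow_le_pow_left₀ (norm_nonneg _) (norm_sum_le _ _) 2).trans sq_sum_le_card_mul_sum_sq
  rw [← h1, norm_mul, Complex.norm_natCast, mul_pow] at h3
  have h4 : (Hs.card : ℝ) * (Hs.card * ‖∑' a, φ a‖ ^ 2) ≤ Hs.card * (P.card * R) := by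
    calc _ = (Hs.card : ℝ) ^ 2 * ‖∑' a, φ a‖ ^ 2 := by ring
      _ ≤ _ := h3
      _ ≤ P.card * (Hs.card * R) := by gcongr
      _ = _ := by ring
  exact le_of_mul_le_mul_left h4 hcard

section Differences

variable {E : Type*} [NormedAddCommGroup E] [NormedSpace ℝ E]

/-- The forward difference of `g` with increment `v`. -/
def translateDiff (v : E) (g : E → ℝ) (x : E) : ℝ := g (x + v) - g x

/-- The derivative of `g` along the vector `e`. -/
noncomputable def derivAlong (e : E) (g : E → ℝ) (x : E) : ℝ := fderiv ℝ g x e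

lemma contDiff_translateDiff {k : ℕ∞} {g : E → ℝ} (hg : ContDiff ℝ k g) (v : E) :
    ContDiff ℝ k (translateDiff v g) :=
  (hg.comp (contDiff_id.add contDiff_const)).sub hg

lemma contDiff_derivAlong {k : ℕ} {g : E → ℝ} (hg : ContDiff ℝ (k + 1 : ℕ) g) (e : E) :
    ContDiff ℝ (k : ℕ) (derivAlong e g) :=
  (hg.fderiv_right (m := (k : ℕ)) (by norm_cast)).clm_apply contDiff_const

lemma derivAlong_translateDiff {g : E → ℝ} (hg : Differentiable ℝ g) (e v : E) :
    derivAlong e (translateDiff v g) = translateDiff v (derivAlong e g) := by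
  funext x
  have h1 : HasFDerivAt (fun y => g (y + v)) (fderiv ℝ g (x + v)) x := by
    have := (hg (x + v)).hasFDerivAt.comp x ((hasFDerivAt_id x).add_const v)
    rwa [ContinuousLinearMap.comp_id] at this
  have h2 := h1.sub (hg x).hasFDerivAt
  have h3 : fderiv ℝ (translateDiff v g) x = fderiv ℝ g (x + v) - fderiv ℝ g x := h2.fderiv
  simp [derivAlong, translateDiff, h3]

lemma iterate_derivAlong_translateDiff (s : ℕ) {g : E → ℝ} (hg : ContDiff ℝ (s : ℕ) g) (e v : E) :
    (derivAlong e)^[s] (translateDiff v g) = translateDiff v ((derivAlong e)^[s] g) := by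
  induction s generalizing g with
  | zero => rfl
  | succ s ih =>
    rw [Function.iterate_succ_apply, Function.iterate_succ_apply,
      derivAlong_translateDiff (hg.differentiable (by simp)) e v]
    exact ih (contDiff_derivAlong hg e)

lemma contDiff_iterate_derivAlong {k : ℕ} (s : ℕ) {g : E → ℝ} (hg : ContDiff ℝ (s + k : ℕ) g)
    (e : E) : ContDiff ℝ (k : ℕ) ((derivAlong e)^[s] g) := by
  induction s generalizing g with
  | zero => simpa using hg
  | succ s ih =>
    rw [Function.iterate_succ_apply]
    exact ih (contDiff_derivAlong (by convert hg using 2; ring) e)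

lemma hasCompactSupport_derivAlong {g : E → ℝ} (hg : HasCompactSupport g) (e : E) :
    HasCompactSupport (derivAlong e g) :=
  hg.fderiv_apply ℝ e

lemma hasCompactSupport_iterate_derivAlong (s : ℕ) {g : E → ℝ} (hg : HasCompactSupport g)
    (e : E) : HasCompactSupport ((derivAlong e)^[s] g) := by
  induction s generalizing g with
  | zero => exact hg
  | succ s ih =>
    rw [Function.iterate_succ_apply]
    exact ih (hasCompactSupport_derivAlong hg e)

lemma exists_derivAlong_eq {g : E → ℝ} (hg : Differentiable ℝ g) (e x : E) {η : ℝ} (hη : 0 < η) :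
    ∃ ξ ∈ Set.Ioo 0 η, translateDiff (η • e) g x = η * derivAlong e g (x + ξ • e) := by
  have hd : ∀ t : ℝ, HasDerivAt (fun t : ℝ => g (x + t • e)) (derivAlong e g (x + t • e)) t := by
    intro t
    have h1 : HasDerivAt (fun t : ℝ => x + t • e) e t := by
      simpa using ((hasDerivAt_id t).smul_const e).const_add x
    exact (hg (x + t • e)).hasFDerivAt.comp_hasDerivAt t h1
  obtain ⟨ξ, hξ, h⟩ := exists_deriv_eq_slope (fun t : ℝ => g (x + t • e)) hη
    (fun t _ => (hd t).continuousAt.continuousWithinAt)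
    (fun t _ => (hd t).differentiableAt.differentiableWithinAt)
  refine ⟨ξ, hξ, ?_⟩
  rw [(hd ξ).deriv] at h
  rw [h]
  simp only [translateDiff, sub_zero, zero_smul, add_zero]
  field_simp

lemma abs_iterate_translateDiff_le (s : ℕ) {g : E → ℝ} (hg : ContDiff ℝ (s : ℕ) g) (e : E) {M : ℝ}
    (hM : ∀ x, |(derivAlong e)^[s] g x| ≤ M) {η : ℝ} (hη : 0 < η) (x : E) :
    |(translateDiff (η • e))^[s] g x| ≤ M * η ^ s := by
  induction s generalizing g M with
  | zero => simpa using hM x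
  | succ s ih =>
    rw [Function.iterate_succ_apply]
    have hdiff : Differentiable ℝ g := hg.differentiable (by simp)
    have key := ih (g := translateDiff (η • e) g) (M := M * η)
      (contDiff_translateDiff (k := s) (hg.of_le (by norm_cast; simp)) _) ?_
    · calc _ ≤ _ := key
        _ = _ := by ring
    · intro y
      rw [iterate_derivAlong_translateDiff s (hg.of_le (by norm_cast; simp))]
      obtain ⟨ξ, -, h⟩ := exists_derivAlong_eq (g := (derivAlong e)^[s] g)
        ((contDiff_iterate_derivAlong (k := 1) s hg e).differentiable (by simp)) e y hη
      rw [h, abs_mul, abs_of_pos hη, mul_comm]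
      have := hM (y + ξ • e)
      rw [Function.iterate_succ_apply'] at this
      gcongr

lemma exists_bound_iterate_translateDiff (s : ℕ) {g : E → ℝ} (hg : ContDiff ℝ (s : ℕ) g)
    (hc : HasCompactSupport g) (e : E) :
    ∃ M ≥ (0 : ℝ), ∀ η > (0 : ℝ), ∀ x, |(translateDiff (η • e))^[s] g x| ≤ M * η ^ s := by
  have h0 : Continuous ((derivAlong e)^[s] g) :=
    (contDiff_iterate_derivAlong (k := 0) s hg e).continuous
  obtain ⟨M, hM⟩ := h0.bounded_above_of_compact_support (hasCompactSupport_iterate_derivAlong s hc e)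
  refine ⟨M, (norm_nonneg _).trans (hM 0), fun η hη x => ?_⟩
  exact abs_iterate_translateDiff_le s hg e (fun y => hM y) hη x

lemma exists_bound_iterate_translateDiff_translateDiff (s : ℕ) {g : E → ℝ}
    (hg : ContDiff ℝ (s + 1 : ℕ) g) (hc : HasCompactSupport g) (e : E) :
    ∃ M ≥ (0 : ℝ), ∀ η > (0 : ℝ), ∀ x h,
      |(translateDiff (η • e))^[s] (translateDiff h g) x| ≤ M * ‖h‖ * η ^ s := by
  have h1 : ContDiff ℝ (1 : ℕ) ((derivAlong e)^[s] g) := contDiff_iterate_derivAlong (k := 1) s hg e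
  have h0 : Continuous (fderiv ℝ ((derivAlong e)^[s] g)) := h1.continuous_fderiv (by simp)
  obtain ⟨M, hM⟩ := h0.bounded_above_of_compact_support
    ((hasCompactSupport_iterate_derivAlong s hc e).fderiv ℝ)
  refine ⟨M, (norm_nonneg _).trans (hM 0), fun η hη x h => ?_⟩
  have hs : ContDiff ℝ (s : ℕ) g := hg.of_le (by norm_cast; simp)
  refine abs_iterate_translateDiff_le s (contDiff_translateDiff (k := s) hs h) e (fun y => ?_) hη x
  rw [iterate_derivAlong_translateDiff s hs]
  have := convex_univ.norm_image_sub_le_of_norm_fderiv_le (𝕜 := ℝ) (f := (derivAlong e)^[s] g)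
    (x := y) (y := y + h)
    (fun z _ => h1.differentiable (by simp) z) (fun z _ => hM z) trivial trivial
  simpa [translateDiff] using this

end Differences

/-- Near a point with nondegenerate Hessian, gradient increments are bounded below in a coordinate
direction depending only on the increment. -/
lemma exists_le_abs_translateDiff_derivAlong {m : ℕ} (hm : 0 < m) {g : (Fin m → ℝ) → ℝ}
    (hg : ContDiff ℝ (2 : ℕ) g) (x₀ : Fin m → ℝ) (hdet : (hess g x₀).det ≠ 0) :
    ∃ r > (0 : ℝ), ∃ c > (0 : ℝ), ∀ h : Fin m → ℝ, ∃ i : Fin m, ∀ y, ‖y - x₀‖ < r →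
      ‖y + h - x₀‖ < r →
      c * ‖h‖ ≤ |translateDiff h (derivAlong (Pi.single i 1) g) y| := by
  set L : Fin m → (Fin m → ℝ) →L[ℝ] ℝ := fun i =>
    fderiv ℝ (derivAlong (Pi.single i 1) g) x₀ with hL
  have hLi : ∀ i h, L i h = Matrix.vecMul h (hess g x₀) i := by
    intro i h
    have := LinearMap.pi_apply_eq_sum_univ (L i).toLinearMap h
    simp only [ContinuousLinearMap.coe_coe, smul_eq_mul] at this
    rw [this]
    simp only [Matrix.vecMul, dotProduct, hess, Matrix.of_apply]
    refine Finset.sum_congr rfl fun j _ => ?_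
    congr 2
    ext l
    simp [Pi.single_apply, eq_comm]
  have hker : LinearMap.ker (ContinuousLinearMap.pi L).toLinearMap = ⊥ := by
    rw [LinearMap.ker_eq_bot']
    intro h hh
    refine Matrix.eq_zero_of_vecMul_eq_zero hdet ?_
    ext i
    rw [← hLi]
    exact congrFun hh i
  obtain ⟨K, hK, hanti⟩ := LinearMap.exists_antilipschitzWith _ hker
  have hK' : (0 : ℝ) < K := hK
  have hC1 : ∀ i, ContDiff ℝ (1 : ℕ) (derivAlong (Pi.single i 1) g) := fun i =>
    contDiff_derivAlong hg _
  have hcont : ∀ i, ∃ r > (0 : ℝ), ∀ y, ‖y - x₀‖ < r →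
      ‖fderiv ℝ (derivAlong (Pi.single i 1) g) y - L i‖ ≤ 1 / (2 * K) := by
    intro i
    have := ((hC1 i).continuous_fderiv (by simp)).continuousAt (x := x₀)
    obtain ⟨r, hr, h⟩ := Metric.continuousAt_iff.mp this (1 / (2 * K)) (by positivity)
    refine ⟨r, hr, fun y hy => ?_⟩
    have := h (x := y) (by rwa [dist_eq_norm])
    rw [dist_eq_norm] at this
    exact this.le
  choose r hr hball using hcont
  have : Nonempty (Fin m) := ⟨⟨0, hm⟩⟩
  obtain ⟨i₀, hi₀⟩ := Finite.exists_min r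
  refine ⟨r i₀, hr i₀, 1 / (2 * K), by positivity, fun h => ?_⟩
  have hbound : ‖h‖ ≤ K * ‖ContinuousLinearMap.pi L h‖ := by
    have := hanti.le_mul_dist h 0
    rwa [dist_zero_right, map_zero, dist_zero_right] at this
  obtain ⟨i, hi⟩ := Finite.exists_max fun i => ‖L i h‖
  have hmax : ‖ContinuousLinearMap.pi L h‖ ≤ ‖L i h‖ := by
    rw [pi_norm_le_iff_of_nonneg (norm_nonneg _)]
    exact hi
  refine ⟨i, fun y hy hyh => ?_⟩
  have hmvt := (convex_ball x₀ (r i)).norm_image_sub_le_of_norm_fderiv_le' (𝕜 := ℝ)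
    (f := derivAlong (Pi.single i 1) g) (φ := L i) (C := 1 / (2 * K)) (x := y) (y := y + h)
    (fun z _ => (hC1 i).differentiable (by simp) z)
    (fun z hz => hball i z (by rwa [mem_ball_iff_norm] at hz))
    (by rw [mem_ball_iff_norm]; exact hy.trans_le (hi₀ i))
    (by rw [mem_ball_iff_norm]; exact hyh.trans_le (hi₀ i))
  rw [add_sub_cancel_left] at hmvt
  have h1 : ‖h‖ / K ≤ ‖L i h‖ := by
    rw [div_le_iff₀ hK', mul_comm]
    exact hbound.trans (by gcongr)
  have h2 := norm_sub_norm_le (L i h) (derivAlong (Pi.single i 1) g (y + h)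
    - derivAlong (Pi.single i 1) g y)
  rw [norm_sub_rev (L i h)] at h2
  have h3 : ‖h‖ / K = 1 / (2 * K) * ‖h‖ + 1 / (2 * K) * ‖h‖ := by field_simp; norm_num
  rw [← Real.norm_eq_abs]
  simp only [translateDiff]
  linarith

/-- The rational point `a / q`. -/
noncomputable def ratPoint {m : ℕ} (q : ℕ) (a : Fin m → ℤ) : Fin m → ℝ := fun i => (a i : ℝ) / q

lemma ratPoint_add {m : ℕ} (q : ℕ) (a b : Fin m → ℤ) :
    ratPoint q (a + b) = ratPoint q a + ratPoint q b := by
  ext i; simp [ratPoint, add_div]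

lemma ratPoint_single {m : ℕ} (q : ℕ) (i : Fin m) :
    ratPoint q (Pi.single i 1) = (1 / q : ℝ) • (Pi.single i 1 : Fin m → ℝ) := by
  ext l
  by_cases h : l = i
  · subst h; simp [ratPoint]
  · simp [ratPoint, h]

/-- The lattice points with all coordinates at most `N` in absolute value. -/
noncomputable def latticeBox (m N : ℕ) : Finset (Fin m → ℤ) :=
  Fintype.piFinset fun _ => Finset.Icc (-(N : ℤ)) N

lemma card_latticeBox (m N : ℕ) : (latticeBox m N).card = (2 * N + 1) ^ m := by
  rw [latticeBox, Fintype.card_piFinset_const, Int.card_Icc]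
  congr 1
  omega

lemma card_latticeBox_mul_le (m B : ℕ) {q : ℕ} (hq : 0 < q) :
    ((latticeBox m (B * q)).card : ℝ) ≤ (2 * B + 1) ^ m * (q : ℝ) ^ m := by
  rw [card_latticeBox, ← mul_pow]
  push_cast
  have : (1 : ℝ) ≤ q := by exact_mod_cast hq
  gcongr
  nlinarith

lemma mem_latticeBox_of_norm_ratPoint_le {m B q : ℕ} (hq : 0 < q) {a : Fin m → ℤ}
    (h : ‖ratPoint q a‖ ≤ B) : a ∈ latticeBox m (B * q) := by
  have hq' : (0 : ℝ) < q := by exact_mod_cast hq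
  rw [latticeBox, Fintype.mem_piFinset]
  intro i
  have h1 : |(a i : ℝ) / q| ≤ B := (norm_le_pi_norm (ratPoint q a) i).trans h
  rw [abs_div, abs_of_pos hq', div_le_iff₀ hq'] at h1
  have h2 : |a i| ≤ ((B * q : ℕ) : ℤ) := by
    have : ((|a i| : ℤ) : ℝ) ≤ (((B * q : ℕ) : ℤ) : ℝ) := by push_cast; exact h1
    exact_mod_cast this
  rw [Finset.mem_Icc]
  exact abs_le.mp h2

lemma norm_single_one {m : ℕ} (i : Fin m) : ‖(Pi.single i 1 : Fin m → ℝ)‖ = 1 := by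
  simp [Pi.norm_single]

/-- The weighted exponential `χ(a/q) exp(i j q g(a/q))`. -/
noncomputable def weightedPhase {m : ℕ} (g χ : (Fin m → ℝ) → ℝ) (q j : ℕ) (a : Fin m → ℤ) : ℂ :=
  χ (ratPoint q a) * unitExp (j * q * g (ratPoint q a))

/-- First and second differences of a product. -/
lemma abs_mul_differences_le {a₀ a₁ a₂ b₀ b₁ b₂ N N₁ N₂ η : ℝ} (hη : 0 < η)
    (ha₀ : |a₀| ≤ N) (hb₀ : |b₀| ≤ N) (hb₁ : |b₁| ≤ N) (hb₂ : |b₂| ≤ N)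
    (ha₀₁ : |a₀ - a₁| ≤ N₁ * η) (hb₀₁ : |b₀ - b₁| ≤ N₁ * η) (hb₁₂ : |b₁ - b₂| ≤ N₁ * η)
    (ha : |a₀ - 2 * a₁ + a₂| ≤ N₂ * η ^ 2) (hb : |b₀ - 2 * b₁ + b₂| ≤ N₂ * η ^ 2) :
    |a₀ * b₀| ≤ N ^ 2 + 2 * N * N₁ + 2 * N * N₂ + 2 * N₁ ^ 2 ∧
    |a₁ * b₁ - a₀ * b₀| ≤ (N ^ 2 + 2 * N * N₁ + 2 * N * N₂ + 2 * N₁ ^ 2) * η ∧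
    |a₂ * b₂ - 2 * (a₁ * b₁) + a₀ * b₀|
      ≤ (N ^ 2 + 2 * N * N₁ + 2 * N * N₂ + 2 * N₁ ^ 2) * η ^ 2 := by
  have hN : 0 ≤ N := (abs_nonneg _).trans ha₀
  have h1 : 0 ≤ N₁ * η := (abs_nonneg _).trans ha₀₁
  have h2 : 0 ≤ N₂ * η ^ 2 := (abs_nonneg _).trans ha
  have hN₁ : 0 ≤ N₁ := nonneg_of_mul_nonneg_left h1 hη
  have hN₂ : 0 ≤ N₂ := nonneg_of_mul_nonneg_left h2 (by positivity)
  have p1 : 0 ≤ N * N₁ := by positivity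
  have p2 : 0 ≤ N * N₂ := by positivity
  have p3 : 0 ≤ N₁ ^ 2 := by positivity
  have p4 : 0 ≤ N ^ 2 := by positivity
  refine ⟨?_, ?_, ?_⟩
  · rw [abs_mul]
    have : |a₀| * |b₀| ≤ N * N := by gcongr
    nlinarith
  · have e : a₁ * b₁ - a₀ * b₀ = -((a₀ - a₁) * b₁) + -(a₀ * (b₀ - b₁)) := by ring
    rw [e]
    refine (abs_add_le _ _).trans ?_
    rw [abs_neg, abs_neg, abs_mul, abs_mul]
    calc |a₀ - a₁| * |b₁| + |a₀| * |b₀ - b₁| ≤ (N₁ * η) * N + N * (N₁ * η) := by gcongr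
      _ = (2 * N * N₁) * η := by ring
      _ ≤ _ := by gcongr; linarith
  · have e : a₂ * b₂ - 2 * (a₁ * b₁) + a₀ * b₀ = a₀ * (b₀ - 2 * b₁ + b₂)
        + 2 * ((a₀ - a₁) * (b₁ - b₂)) + (a₀ - 2 * a₁ + a₂) * b₂ := by ring
    rw [e]
    refine (abs_add_three _ _ _).trans ?_
    rw [abs_mul, abs_mul, abs_mul, abs_mul, abs_two]
    calc |a₀| * |b₀ - 2 * b₁ + b₂| + 2 * (|a₀ - a₁| * |b₁ - b₂|) + |a₀ - 2 * a₁ + a₂| * |b₂|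
        ≤ N * (N₂ * η ^ 2) + 2 * ((N₁ * η) * (N₁ * η)) + (N₂ * η ^ 2) * N := by gcongr
      _ = (2 * N * N₂ + 2 * N₁ ^ 2) * η ^ 2 := by ring
      _ ≤ _ := by gcongr; linarith

/-- Bounds uniform in the coordinate directions. -/
lemma exists_uniform_bound {m : ℕ} {P : Fin m → ℝ → Prop}
    (hP : ∀ i, ∃ M ≥ (0 : ℝ), P i M) (hmono : ∀ i M M', M ≤ M' → P i M → P i M') :
    ∃ M ≥ (0 : ℝ), ∀ i, P i M := by
  choose M hM hPM using hP
  exact ⟨∑ i, M i, Finset.sum_nonneg fun i _ => hM i, fun i =>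
    hmono i _ _ (Finset.single_le_sum (fun i _ => hM i) (Finset.mem_univ i)) (hPM i)⟩

/-- Decay of the correlations of a weighted exponential near a point where the Hessian of the
phase is nondegenerate. -/
lemma exists_norm_tsum_correlation_le {m : ℕ} (hm : 0 < m) {g : (Fin m → ℝ) → ℝ}
    (hg : ContDiff ℝ (4 : ℕ) g) (hgc : HasCompactSupport g) (x₀ : Fin m → ℝ)
    (hdet : (hess g x₀).det ≠ 0) :
    ∃ r > (0 : ℝ), ∀ χ : (Fin m → ℝ) → ℝ, ContDiff ℝ (2 : ℕ) χ →
      (∀ x, χ x ≠ 0 → ‖x - x₀‖ < r) →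
      ∃ C > (0 : ℝ), ∃ c > (0 : ℝ), ∃ q₀ : ℕ, ∀ q : ℕ, q₀ ≤ q → 0 < q → ∀ j : ℕ, 1 ≤ j →
        ∀ k : Fin m → ℤ, k ≠ 0 → j * ‖ratPoint q k‖ ≤ c →
        ‖∑' a, weightedPhase g χ q j (a + k) * (starRingEnd ℂ) (weightedPhase g χ q j a)‖
          ≤ C * (q : ℝ) ^ m / (j * q * ‖ratPoint q k‖) ^ 2 := by
  obtain ⟨r, hr, c, hc, hlow⟩ := exists_le_abs_translateDiff_derivAlong hm
    (hg.of_le (by norm_cast)) x₀ hdet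
  have hpow : ∀ {h' : Fin m → ℝ} {η : ℝ} (s : ℕ) (M M' : ℝ), 0 < η → M ≤ M' →
      M * ‖h'‖ * η ^ s ≤ M' * ‖h'‖ * η ^ s := fun s M M' hη hMM => by gcongr
  obtain ⟨M₁, hM₁, hT₁⟩ := exists_uniform_bound
    (fun i : Fin m => exists_bound_iterate_translateDiff_translateDiff 1 (hg.of_le (by norm_cast))
      hgc (Pi.single i 1))
    (fun i M M' hMM H η hη x h => (H η hη x h).trans (hpow 1 M M' hη hMM))
  obtain ⟨M₂, hM₂, hT₂⟩ := exists_uniform_bound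
    (fun i : Fin m => exists_bound_iterate_translateDiff_translateDiff 2 (hg.of_le (by norm_cast))
      hgc (Pi.single i 1))
    (fun i M M' hMM H η hη x h => (H η hη x h).trans (hpow 2 M M' hη hMM))
  obtain ⟨M₃, hM₃, hT₃⟩ := exists_uniform_bound
    (fun i : Fin m => exists_bound_iterate_translateDiff_translateDiff 3 hg hgc (Pi.single i 1))
    (fun i M M' hMM H η hη x h => (H η hη x h).trans (hpow 3 M M' hη hMM))
  refine ⟨r / 4, by positivity, fun χ hχ hχs => ?_⟩
  have hχc : HasCompactSupport χ := by
    refine HasCompactSupport.of_support_subset_isCompact (isCompact_closedBall x₀ (r / 4)) ?_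
    intro x hx
    rw [mem_closedBall_iff_norm]
    exact (hχs x hx).le
  have hpow' : ∀ {η : ℝ} (s : ℕ) (M M' : ℝ), 0 < η → M ≤ M' →
      M * η ^ s ≤ M' * η ^ s := fun s M M' hη hMM => by gcongr
  obtain ⟨N, hN⟩ := hχ.continuous.bounded_above_of_compact_support hχc
  obtain ⟨N₁, hN₁, hX₁⟩ := exists_uniform_bound
    (fun i : Fin m => exists_bound_iterate_translateDiff 1 (hχ.of_le (by norm_cast)) hχc
      (Pi.single i 1))
    (fun i M M' hMM H η hη x => (H η hη x).trans (hpow' 1 M M' hη hMM))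
  obtain ⟨N₂, hN₂, hX₂⟩ := exists_uniform_bound
    (fun i : Fin m => exists_bound_iterate_translateDiff 2 hχ hχc (Pi.single i 1))
    (fun i M M' hMM H η hη x => (H η hη x).trans (hpow' 2 M M' hη hMM))
  have hN0 : 0 ≤ N := (norm_nonneg _).trans (hN 0)
  obtain ⟨K, hK, hkey⟩ := exists_inv_unitExp_sub_one_bounds (c := c) (C := M₂ + M₃ + 1) hc
    (by positivity)
  obtain ⟨B, hB⟩ := exists_nat_ge (‖x₀‖ + r)
  obtain ⟨q₀, hq₀⟩ := exists_nat_ge (12 / r)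
  set N' := N ^ 2 + 2 * N * N₁ + 2 * N * N₂ + 2 * N₁ ^ 2 with hN'
  have hN'0 : 0 ≤ N' := by positivity
  refine ⟨(2 * B + 1) ^ m * (6 * N' * K ^ 2) + 1, by positivity,
    min (r / 4) (1 / (2 * M₁ + 1)), by positivity, q₀, ?_⟩
  intro q hq hq0 j hj k hk hjk
  have hq' : (0 : ℝ) < q := by exact_mod_cast hq0
  have hj' : (1 : ℝ) ≤ j := by exact_mod_cast hj
  set h := ratPoint q k with hh
  obtain ⟨η, hη⟩ : ∃ η : ℝ, η = 1 / q := ⟨_, rfl⟩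
  have hηpos : 0 < η := by rw [hη]; positivity
  have hηr : 3 * η ≤ r / 4 := by
    have h1 : 12 / r ≤ q := hq₀.trans (by exact_mod_cast hq)
    rw [div_le_iff₀ hr] at h1
    rw [hη, mul_one_div, div_le_iff₀ hq']
    linarith
  have hhpos : 0 < ‖h‖ := by
    rw [norm_pos_iff]
    intro h0
    apply hk
    ext i
    have := congrFun h0 i
    simp only [hh, ratPoint, Pi.zero_apply, div_eq_zero_iff, hq'.ne', or_false] at this
    exact_mod_cast this
  obtain ⟨ρ, hρ⟩ : ∃ ρ : ℝ, ρ = j * ‖h‖ := ⟨_, rfl⟩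
  have hρpos : 0 < ρ := by rw [hρ]; positivity
  have hρr : ρ ≤ r / 4 := by rw [hρ]; exact hjk.trans (min_le_left _ _)
  have hρM : ρ * (2 * M₁ + 1) ≤ 1 := by
    rw [← le_div_iff₀ (by positivity), hρ]; exact hjk.trans (min_le_right _ _)
  have hρ1 : ρ ≤ 1 := by nlinarith
  have hhr : ‖h‖ ≤ r / 4 := by
    refine le_trans ?_ hρr
    rw [hρ]
    exact le_mul_of_one_le_left hhpos.le hj'
  have hμ : ∀ y : ℝ, j * q * (y * ‖h‖ * η) = y * ρ := by
    intro y; rw [hη, hρ]; field_simp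
  obtain ⟨i, hi⟩ := hlow h
  set e : Fin m → ℤ := Pi.single i 1 with he
  set v : Fin m → ℝ := Pi.single i 1 with hv
  have hv1 : ‖v‖ = 1 := norm_single_one i
  have hxe : ∀ a, ratPoint q (a + e) = ratPoint q a + η • v := fun a => by
    rw [ratPoint_add, he, ratPoint_single, hη]
  have hxe' : ∀ a, ratPoint q a = ratPoint q (a - e) + η • v := fun a => by
    rw [← hxe, sub_add_cancel]
  set W := translateDiff h g with hW
  set V := translateDiff (η • v) W with hV
  have hWk : ∀ a, W (ratPoint q a) = g (ratPoint q (a + k)) - g (ratPoint q a) := fun a => by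
    rw [ratPoint_add]; rfl
  set d : (Fin m → ℤ) → ℝ := fun a => j * q * V (ratPoint q a) with hd
  set u : (Fin m → ℤ) → ℂ := fun a => ((χ (ratPoint q a) * χ (ratPoint q a + h) : ℝ) : ℂ) with hu
  have hcorr : ∀ a, weightedPhase g χ q j (a + k) * (starRingEnd ℂ) (weightedPhase g χ q j a) =
      u a * unitExp (j * q * W (ratPoint q a)) := by
    intro a
    rw [weightedPhase, weightedPhase, map_mul, conj_unitExp, Complex.conj_ofReal, hWk]
    have : unitExp (j * q * (g (ratPoint q (a + k)) - g (ratPoint q a))) =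
        unitExp (j * q * g (ratPoint q (a + k))) * unitExp (-(j * q * g (ratPoint q a))) := by
      rw [← unitExp_add]; ring_nf
    rw [this, hu, ratPoint_add]
    push_cast
    ring
  rw [tsum_congr hcorr]
  have hu0 : ∀ a, u a ≠ 0 → ‖ratPoint q a - x₀‖ < r / 4 := by
    intro a ha
    apply hχs
    intro h0
    exact ha (by simp [hu, h0])
  have hηv : ‖η • v‖ = η := by rw [norm_smul, hv1, mul_one, Real.norm_of_nonneg hηpos.le]
  -- any point in range is close to `x₀`
  have hnear : ∀ a, u a ≠ 0 ∨ u (a - e) ≠ 0 ∨ u (a - e - e) ≠ 0 →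
      ‖ratPoint q (a - e - e) - x₀‖ < r / 4 + 2 * η := by
    intro a ha
    have s1 : ratPoint q (a - e - e) - x₀ = (ratPoint q (a - e) - x₀) - η • v := by
      rw [hxe' (a - e)]; abel
    have s2 : ratPoint q (a - e) - x₀ = (ratPoint q a - x₀) - η • v := by
      rw [hxe' a]; abel
    have t1 := norm_sub_le (ratPoint q (a - e) - x₀) (η • v)
    have t2 := norm_sub_le (ratPoint q a - x₀) (η • v)
    rw [← s1, hηv] at t1
    rw [← s2, hηv] at t2
    rcases ha with ha | ha | ha
    · have := hu0 _ ha; linarith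
    · have := hu0 _ ha; linarith
    · have := hu0 _ ha; linarith
  have hlower : ∀ y : Fin m → ℝ, ‖y - x₀‖ < r / 4 + 4 * η → c * ρ ≤ |j * q * V y| := by
    intro y hy
    obtain ⟨ξ, hξ, h1⟩ := exists_derivAlong_eq (g := W)
      ((contDiff_translateDiff (k := 4) hg h).differentiable (by simp)) v y hηpos
    rw [hV, h1, hW, derivAlong_translateDiff (hg.differentiable (by simp))]
    have hξv : ‖ξ • v‖ ≤ η := by
      rw [norm_smul, hv1, mul_one, Real.norm_of_nonneg hξ.1.le]; exact hξ.2.le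
    have b1 : ‖y + ξ • v - x₀‖ < r / 4 + 5 * η := by
      have : y + ξ • v - x₀ = (y - x₀) + ξ • v := by abel
      rw [this]
      exact (norm_add_le _ _).trans_lt (by linarith)
    have b2 : ‖y + ξ • v + h - x₀‖ < r := by
      have : y + ξ • v + h - x₀ = (y + ξ • v - x₀) + h := by abel
      rw [this]
      exact (norm_add_le _ _).trans_lt (by linarith)
    have := hi (y + ξ • v) (by linarith) b2
    rw [abs_mul, abs_of_pos (by positivity : (0 : ℝ) < j * q), abs_mul, abs_of_pos hηpos]
    calc c * ρ = j * q * (c * ‖h‖ * η) := (hμ c).symm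
      _ = j * q * (η * (c * ‖h‖)) := by ring
      _ ≤ _ := by gcongr
  have hupper : ∀ y : Fin m → ℝ, |j * q * V y| ≤ 1 / 2 := by
    intro y
    have := hT₁ i η hηpos y h
    simp only [Function.iterate_one, pow_one] at this
    rw [abs_mul, abs_of_pos (by positivity : (0 : ℝ) < j * q)]
    calc j * q * |V y| ≤ j * q * (M₁ * ‖h‖ * η) := by gcongr
      _ = M₁ * ρ := hμ _
      _ ≤ 1 / 2 := by nlinarith
  have hVdiff : ∀ a, |d a - d (a - e)| ≤ (M₂ + M₃ + 1) * (η * ρ) := by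
    intro a
    have h1 := hT₂ i η hηpos (ratPoint q (a - e)) h
    have h2 : d a - d (a - e) = j * q * (translateDiff (η • v))^[2] W (ratPoint q (a - e)) := by
      simp only [hd, Function.iterate_succ, Function.iterate_zero, Function.comp, id]
      rw [hxe' a]
      simp only [translateDiff, hV]
      ring
    rw [h2, abs_mul, abs_of_pos (by positivity : (0 : ℝ) < j * q)]
    calc _ ≤ j * q * (M₂ * ‖h‖ * η ^ 2) := by gcongr
      _ = j * q * ((M₂ * η) * ‖h‖ * η) := by ring
      _ = M₂ * η * ρ := hμ _
      _ = M₂ * (η * ρ) := by ring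
      _ ≤ _ := by gcongr; linarith
  have hVdiff2 : ∀ a, |d a - 2 * d (a - e) + d (a - e - e)| ≤
      (M₂ + M₃ + 1) * (η ^ 2 * ρ) := by
    intro a
    have h1 := hT₃ i η hηpos (ratPoint q (a - e - e)) h
    have h2 : d a - 2 * d (a - e) + d (a - e - e) =
        j * q * (translateDiff (η • v))^[3] W (ratPoint q (a - e - e)) := by
      simp only [hd, Function.iterate_succ, Function.iterate_zero, Function.comp, id]
      rw [hxe' a, hxe' (a - e)]
      simp only [translateDiff, hV]
      ring
    rw [h2, abs_mul, abs_of_pos (by positivity : (0 : ℝ) < j * q)]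
    calc _ ≤ j * q * (M₃ * ‖h‖ * η ^ 3) := by gcongr
      _ = j * q * ((M₃ * η ^ 2) * ‖h‖ * η) := by ring
      _ = M₃ * η ^ 2 * ρ := hμ _
      _ = M₃ * (η ^ 2 * ρ) := by ring
      _ ≤ _ := by gcongr; linarith
  have hχ1 : ∀ y y' : Fin m → ℝ, y' = y + η • v → |χ y' - χ y| ≤ N₁ * η := by
    rintro y y' rfl
    have := hX₁ i η hηpos y
    simpa [translateDiff] using this
  have hχ2 : ∀ y y' y'' : Fin m → ℝ, y' = y + η • v → y'' = y' + η • v →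
      |χ y'' - 2 * χ y' + χ y| ≤ N₂ * η ^ 2 := by
    rintro y y' y'' rfl rfl
    have := hX₂ i η hηpos y
    simp only [Function.iterate_succ, Function.iterate_zero, Function.comp, id,
      translateDiff] at this
    convert this using 2
    ring
  have hubound : ∀ a, ‖u a‖ ≤ N' ∧ ‖u (a - e) - u a‖ ≤ N' * η ∧
      ‖u (a - e - e) - 2 * u (a - e) + u a‖ ≤ N' * η ^ 2 := by
    intro a
    have x1 := hxe' a
    have x2 := hxe' (a - e)
    have y1 : ratPoint q a + h = (ratPoint q (a - e) + h) + η • v := by rw [x1]; abel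
    have y2 : ratPoint q (a - e) + h = (ratPoint q (a - e - e) + h) + η • v := by rw [x2]; abel
    obtain ⟨r1, r2, r3⟩ := abs_mul_differences_le hηpos (hN (ratPoint q a))
      (hN (ratPoint q a + h)) (hN (ratPoint q (a - e) + h)) (hN (ratPoint q (a - e - e) + h))
      (hχ1 _ _ x1) (hχ1 _ _ y1) (hχ1 _ _ y2) (hχ2 _ _ _ x2 x1) (hχ2 _ _ _ y2 y1)
    refine ⟨?_, ?_, ?_⟩
    · rw [hu, Complex.norm_real]; exact r1
    · simp only [hu]; rw [← Complex.ofReal_sub, Complex.norm_real]; exact r2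
    · have : u (a - e - e) - 2 * u (a - e) + u a =
        ((χ (ratPoint q (a - e - e)) * χ (ratPoint q (a - e - e) + h)
          - 2 * (χ (ratPoint q (a - e)) * χ (ratPoint q (a - e) + h))
          + χ (ratPoint q a) * χ (ratPoint q a + h) : ℝ) : ℂ) := by
        simp only [hu]; push_cast; ring
      rw [this, Complex.norm_real]; exact r3
  have hmem : ∀ a, u a ≠ 0 ∨ u (a - e) ≠ 0 ∨ u (a - e - e) ≠ 0 → a ∈ latticeBox m (B * q) := by
    intro a ha
    refine mem_latticeBox_of_norm_ratPoint_le hq0 (le_trans ?_ hB)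
    have : ratPoint q a = (ratPoint q (a - e - e) - x₀) + (η • v + η • v) + x₀ := by
      rw [hxe' a, hxe' (a - e)]; abel
    rw [this]
    have t1 := norm_add₃_le (a := ratPoint q (a - e - e) - x₀) (b := η • v + η • v) (c := x₀)
    have t2 := norm_add_le (η • v) (η • v)
    rw [hηv] at t2
    have := hnear a ha
    linarith
  have hfin : u.HasFiniteSupport :=
    Set.Finite.subset (latticeBox m (B * q)).finite_toSet fun a ha => hmem a (Or.inl ha)
  have hmain := norm_tsum_mul_le_of_translate (fun a => unitExp (j * q * W (ratPoint q a)))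
    (fun a => unitExp (d a) - 1) u e (latticeBox m (B * q)) hfin
    (fun a => by
      have : j * q * W (ratPoint q (a + e)) = j * q * W (ratPoint q a) + d a := by
        simp only [hd, hV]; rw [hxe]; simp only [translateDiff]; ring
      rw [this, unitExp_add]; ring)
    (fun a => norm_unitExp _)
    (fun a ha => by
      by_contra h0
      refine ha (hmem a ?_)
      by_contra! h1
      exact h0 h1)
    (6 * N' * K ^ 2 * (η / ρ) ^ 2) (by positivity)
    (fun a ha => by
      have n2 := hnear a ha
      have n1 : ‖ratPoint q (a - e) - x₀‖ < r / 4 + 3 * η := by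
        have : ratPoint q (a - e) - x₀ = (ratPoint q (a - e - e) - x₀) + η • v := by
          rw [hxe' (a - e)]; abel
        rw [this]
        exact (norm_add_le _ _).trans_lt (by linarith)
      have n0 : ‖ratPoint q a - x₀‖ < r / 4 + 4 * η := by
        have : ratPoint q a - x₀ = (ratPoint q (a - e) - x₀) + η • v := by
          rw [hxe' a]; abel
        rw [this]
        exact (norm_add_le _ _).trans_lt (by linarith)
      obtain ⟨⟨z0, -, -⟩, k0, k1, k2, k01, k12, k012⟩ := hkey ρ η (d a) (d (a - e)) (d (a - e - e))
        hρpos hρ1 hηpos (hlower _ (by linarith)) (hlower _ (by linarith)) (hlower _ (by linarith))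
        (hupper _) (hupper _) (hupper _) (hVdiff a) (hVdiff (a - e)) (hVdiff2 a)
      obtain ⟨u0, u01, u012⟩ := hubound a
      exact ⟨z0, norm_iterated_parts_le hK.le hηpos hρpos k1 k2 k01 k12 k012 u0 u01 u012⟩)
  refine hmain.trans ?_
  have hηρ : (η / ρ) ^ 2 = 1 / (j * q * ‖h‖) ^ 2 := by
    rw [hη, hρ, ← one_div_pow]; congr 1; field_simp
  rw [hηρ, ← mul_div_assoc, mul_one, ← mul_div_assoc]
  refine div_le_div_of_nonneg_right ?_ (by positivity)
  calc ((latticeBox m (B * q)).card : ℝ) * (6 * N' * K ^ 2)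
      ≤ ((2 * B + 1) ^ m * (q : ℝ) ^ m) * (6 * N' * K ^ 2) := by
        gcongr; exact card_latticeBox_mul_le m B hq0
    _ = (2 * B + 1) ^ m * (6 * N' * K ^ 2) * (q : ℝ) ^ m := by ring
    _ ≤ _ := mul_le_mul_of_nonneg_right (by linarith) (by positivity)

/-- The weight `1 / max 1 |x|`. -/
noncomputable def recipWeight (x : ℤ) : ℝ := (max 1 |(x : ℝ)|)⁻¹

lemma recipWeight_nonneg (x : ℤ) : 0 ≤ recipWeight x := by
  rw [recipWeight]; positivity

lemma sum_recipWeight_range_le (N : ℕ) :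
    ∑ z ∈ Finset.range N, recipWeight z ≤ 2 + Real.log N := by
  rcases N.eq_zero_or_pos with rfl | hN
  · simp
  obtain ⟨M, rfl⟩ : ∃ M, N = M + 1 := ⟨N - 1, by omega⟩
  rw [Finset.sum_range_succ']
  have h1 : ∑ z ∈ Finset.range M, recipWeight ((z + 1 : ℕ) : ℤ) = ((harmonic M : ℚ) : ℝ) := by
    rw [harmonic, Rat.cast_sum]
    refine Finset.sum_congr rfl fun z _ => ?_
    have : |(((z + 1 : ℕ) : ℤ) : ℝ)| = z + 1 := by push_cast; exact abs_of_pos (by positivity)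
    rw [recipWeight, this, max_eq_right (by linarith [(Nat.cast_nonneg z : (0 : ℝ) ≤ z)])]
    push_cast
    rfl
  have h2 := harmonic_le_one_add_log M
  have h3 : Real.log M ≤ Real.log ((M + 1 : ℕ) : ℝ) := by
    rcases M.eq_zero_or_pos with rfl | hM
    · simp
    · apply Real.log_le_log (by exact_mod_cast hM)
      push_cast; linarith
  have h4 : recipWeight ((0 : ℕ) : ℤ) = 1 := by simp [recipWeight]
  rw [h1, h4]
  linarith

lemma sum_recipWeight_sub_le {H : ℕ} {y : ℤ} (hy : y ∈ Finset.Ico (0 : ℤ) H) :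
    ∑ x ∈ Finset.Ico (0 : ℤ) H, recipWeight (x - y) ≤ 4 + 2 * Real.log H := by
  rw [Finset.mem_Ico] at hy
  have h1 : ∑ x ∈ Finset.Ico (0 : ℤ) H, recipWeight (x - y) ≤
      ∑ x ∈ Finset.Ico (0 : ℤ) H, ∑ z ∈ Finset.range H,
        ((if x - y = (z : ℤ) then recipWeight z else 0) +
          if x - y = -(z : ℤ) then recipWeight z else 0) := by
    refine Finset.sum_le_sum fun x hx => ?_
    rw [Finset.mem_Ico] at hx
    have hnn : ∀ z : ℕ, 0 ≤ (if x - y = (z : ℤ) then recipWeight z else 0) +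
        (if x - y = -(z : ℤ) then recipWeight z else 0) := fun z => by
      have := recipWeight_nonneg z
      split_ifs <;> linarith
    refine le_trans ?_ (Finset.single_le_sum (fun z _ => hnn z)
      (Finset.mem_range.mpr (by omega : (x - y).natAbs < H)))
    have hw : recipWeight (((x - y).natAbs : ℕ) : ℤ) = recipWeight (x - y) := by
      rw [recipWeight, recipWeight, ← Int.cast_abs, ← Int.cast_abs, Int.natCast_natAbs, abs_abs]
    have := recipWeight_nonneg (x - y)
    rw [hw]
    rcases Int.natAbs_eq (x - y) with h | h
    · rw [if_pos h]
      split_ifs <;> linarith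
    · rw [if_pos h]
      split_ifs <;> linarith
  refine h1.trans ?_
  rw [Finset.sum_comm]
  have h2 : ∀ z ∈ Finset.range H, ∑ x ∈ Finset.Ico (0 : ℤ) H,
      ((if x - y = (z : ℤ) then recipWeight z else 0) +
        if x - y = -(z : ℤ) then recipWeight z else 0) ≤ 2 * recipWeight z := by
    intro z _
    have hz := recipWeight_nonneg z
    rw [Finset.sum_add_distrib]
    have e1 : ∀ x : ℤ, (x - y = (z : ℤ)) = (x = y + z) := fun x => by
      rw [sub_eq_iff_eq_add, add_comm]
    have e2 : ∀ x : ℤ, (x - y = -(z : ℤ)) = (x = y - z) := fun x => by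
      rw [sub_eq_iff_eq_add, neg_add_eq_sub]
    simp only [e1, e2, Finset.sum_ite_eq']
    split_ifs <;> linarith
  refine (Finset.sum_le_sum h2).trans ?_
  rw [← Finset.mul_sum]
  have := sum_recipWeight_range_le H
  linarith

/-- The cube `[0, H)^m`. -/
noncomputable def latticeCube (m H : ℕ) : Finset (Fin m → ℤ) :=
  Fintype.piFinset fun _ => Finset.Ico (0 : ℤ) H

lemma card_latticeCube (m H : ℕ) : (latticeCube m H).card = H ^ m := by
  rw [latticeCube, Fintype.card_piFinset_const, Int.card_Ico]
  simp

lemma sum_latticeCube_recipWeight_le {m H : ℕ} (hH : 0 < H) {i₀ i₁ : Fin m} (hi : i₀ ≠ i₁)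
    {h' : Fin m → ℤ} (hh' : h' ∈ latticeCube m H) :
    ∑ h ∈ latticeCube m H, recipWeight ((h - h') i₀) * recipWeight ((h - h') i₁) ≤
      (H : ℝ) ^ m * ((4 + 2 * Real.log H) / H) ^ 2 := by
  have hH' : (0 : ℝ) < H := by exact_mod_cast hH
  have h1 : ∀ h : Fin m → ℤ, recipWeight ((h - h') i₀) * recipWeight ((h - h') i₁) =
      ∏ i, if i = i₀ ∨ i = i₁ then recipWeight (h i - h' i) else 1 := by
    intro h
    have : ∀ i, (if i = i₀ ∨ i = i₁ then recipWeight (h i - h' i) else 1) =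
        (if i = i₀ then recipWeight (h i - h' i) else 1) *
          (if i = i₁ then recipWeight (h i - h' i) else 1) := by
      intro i
      by_cases h0 : i = i₀
      · have : i ≠ i₁ := h0 ▸ hi
        simp [h0, hi]
      · simp [h0]
    rw [Finset.prod_congr rfl fun i _ => this i, Finset.prod_mul_distrib]
    simp
  have h2 : ((H : ℝ)) ^ m * ((4 + 2 * Real.log H) / H) ^ 2 =
      ∏ i : Fin m, if i = i₀ ∨ i = i₁ then (4 + 2 * Real.log H) else (H : ℝ) := by
    have : ∀ i, (if i = i₀ ∨ i = i₁ then (4 + 2 * Real.log H) else (H : ℝ)) =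
        (H : ℝ) * ((if i = i₀ then (4 + 2 * Real.log H) / H else 1) *
          (if i = i₁ then (4 + 2 * Real.log H) / H else 1)) := by
      intro i
      by_cases h0 : i = i₀
      · have : i ≠ i₁ := h0 ▸ hi
        simp only [h0, hi, true_or, if_true, if_false, mul_one]
        field_simp
      · by_cases h1 : i = i₁
        · simp only [h1, hi.symm, or_true, if_true, if_false, one_mul]
          field_simp
        · simp [h0, h1]
    rw [Finset.prod_congr rfl fun i _ => this i, Finset.prod_mul_distrib, Finset.prod_mul_distrib]
    simp [sq]
  rw [Finset.sum_congr rfl fun h _ => h1 h, h2, latticeCube,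
    ← Finset.prod_univ_sum (fun _ => Finset.Ico (0 : ℤ) H)
      (fun i x => if i = i₀ ∨ i = i₁ then recipWeight (x - h' i) else 1)]
  refine Finset.prod_le_prod (fun i _ => Finset.sum_nonneg fun x _ => ?_) fun i _ => ?_
  · have := recipWeight_nonneg (x - h' i)
    split_ifs <;> linarith
  · split_ifs
    · exact sum_recipWeight_sub_le (Fintype.mem_piFinset.mp hh' i)
    · simp

lemma inv_sq_le_recipWeight_mul {m q : ℕ} (hq : 0 < q) {k : Fin m → ℤ} (hk : k ≠ 0)
    (i₀ i₁ : Fin m) :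
    ((q * ‖ratPoint q k‖) ^ 2)⁻¹ ≤ recipWeight (k i₀) * recipWeight (k i₁) := by
  have hq' : (0 : ℝ) < q := by exact_mod_cast hq
  have h1 : ∀ i, |(k i : ℝ)| ≤ q * ‖ratPoint q k‖ := by
    intro i
    have : |(k i : ℝ) / q| ≤ ‖ratPoint q k‖ := norm_le_pi_norm (ratPoint q k) i
    rw [abs_div, abs_of_pos hq', div_le_iff₀ hq'] at this
    linarith
  obtain ⟨i, hi⟩ := Function.ne_iff.mp hk
  have h2 : 1 ≤ q * ‖ratPoint q k‖ := by
    refine le_trans ?_ (h1 i)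
    exact_mod_cast Int.one_le_abs hi
  rw [recipWeight, recipWeight, ← mul_inv]
  refine inv_anti₀ (by positivity) ?_
  rw [sq]
  exact mul_le_mul (max_le h2 (h1 _)) (max_le h2 (h1 _)) (by positivity) (by positivity)

lemma norm_tsum_le_card_mul {G : Type*} (φ : G → ℂ) (S : Finset G) {N : ℝ}
    (hS : ∀ a, a ∉ S → φ a = 0) (hN : ∀ a, ‖φ a‖ ≤ N) : ‖∑' a, φ a‖ ≤ S.card * N := by
  rw [tsum_eq_sum (s := S) hS, ← nsmul_eq_mul]
  exact (norm_sum_le _ _).trans (Finset.sum_le_card_nsmul _ _ _ fun a _ => hN a)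

lemma norm_weightedPhase_le {m : ℕ} {g χ : (Fin m → ℝ) → ℝ} {N : ℝ} (hN : ∀ x, ‖χ x‖ ≤ N)
    (q j : ℕ) (a : Fin m → ℤ) : ‖weightedPhase g χ q j a‖ ≤ N := by
  rw [weightedPhase, norm_mul, norm_unitExp, mul_one, Complex.norm_real]
  exact hN _

lemma mem_latticeBox_of_weightedPhase_ne_zero {m B q : ℕ} (hq : 0 < q) {g χ : (Fin m → ℝ) → ℝ}
    (hχ : ∀ x, χ x ≠ 0 → ‖x‖ ≤ B) {j : ℕ} {a : Fin m → ℤ} (ha : weightedPhase g χ q j a ≠ 0) :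
    a ∈ latticeBox m (B * q) := by
  refine mem_latticeBox_of_norm_ratPoint_le hq (hχ _ fun h0 => ha ?_)
  simp [weightedPhase, h0]

set_option maxHeartbeats 1000000 in
/-- Bound for a weighted exponential sum near a point where the Hessian of the phase is
nondegenerate. -/
lemma exists_sq_norm_tsum_weightedPhase_le {m : ℕ} (hm : 2 ≤ m) {g : (Fin m → ℝ) → ℝ}
    (hg : ContDiff ℝ (4 : ℕ) g) (hgc : HasCompactSupport g) (x₀ : Fin m → ℝ)
    (hdet : (hess g x₀).det ≠ 0) :
    ∃ r > (0 : ℝ), ∀ χ : (Fin m → ℝ) → ℝ, ContDiff ℝ (2 : ℕ) χ →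
      (∀ x, χ x ≠ 0 → ‖x - x₀‖ < r) →
      ∃ C > (0 : ℝ), ∀ q : ℕ, 0 < q → ∀ j : ℕ, 1 ≤ j →
        ‖∑' a, weightedPhase g χ q j a‖ ^ 2 ≤
          C * (((q : ℝ) * j) ^ m + ((q : ℝ) ^ (m - 1) * (1 + Real.log q)) ^ 2) := by
  obtain ⟨r, hr, hG⟩ := exists_norm_tsum_correlation_le (by omega) hg hgc x₀ hdet
  refine ⟨r, hr, fun χ hχ hχs => ?_⟩
  obtain ⟨C, hC, c₀, hc₀, q₀, hcor⟩ := hG χ hχ hχs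
  have hχc : HasCompactSupport χ := by
    refine HasCompactSupport.of_support_subset_isCompact (isCompact_closedBall x₀ r) ?_
    intro x hx
    rw [mem_closedBall_iff_norm]
    exact (hχs x hx).le
  obtain ⟨N, hN⟩ := hχ.continuous.bounded_above_of_compact_support hχc
  have hN0 : 0 ≤ N := (norm_nonneg _).trans (hN 0)
  obtain ⟨B, hB⟩ := exists_nat_ge (‖x₀‖ + r)
  have hχB : ∀ x, χ x ≠ 0 → ‖x‖ ≤ B := by
    intro x hx
    have h1 := hχs x hx
    have h2 := norm_add_le (x - x₀) x₀
    rw [sub_add_cancel] at h2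
    linarith
  obtain ⟨A₁, hA₁⟩ : ∃ A : ℝ, A = (2 * B + 1) ^ m := ⟨_, rfl⟩
  have hA₁0 : 0 < A₁ := by rw [hA₁]; positivity
  obtain ⟨A₂, hA₂⟩ : ∃ A : ℝ, A = (2 * ((B + 1 : ℕ) : ℝ) + 1) ^ m := ⟨_, rfl⟩
  have hA₂0 : 0 < A₂ := by rw [hA₂]; positivity
  obtain ⟨c, hc⟩ : ∃ c : ℝ, c = min c₀ 1 := ⟨_, rfl⟩
  have hc0 : 0 < c := by rw [hc]; positivity
  have hcc₀ : c ≤ c₀ := hc ▸ min_le_left _ _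
  have hc1 : c ≤ 1 := hc ▸ min_le_right _ _
  refine ⟨(A₁ * N) ^ 2 * q₀ ^ m + A₂ * A₁ * N ^ 2 / c ^ m + A₂ * C * (6 / c) ^ 2 + 1,
    by positivity, ?_⟩
  intro q hq j hj
  have hq' : (0 : ℝ) < q := by exact_mod_cast hq
  have hq1 : (1 : ℝ) ≤ q := by exact_mod_cast hq
  have hj' : (1 : ℝ) ≤ j := by exact_mod_cast hj
  have hlog : 0 ≤ Real.log q := Real.log_nonneg hq1
  obtain ⟨T₁, hT₁⟩ : ∃ T : ℝ, T = ((q : ℝ) * j) ^ m := ⟨_, rfl⟩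
  obtain ⟨T₂, hT₂⟩ : ∃ T : ℝ, T = ((q : ℝ) ^ (m - 1) * (1 + Real.log q)) ^ 2 := ⟨_, rfl⟩
  have hT₁0 : 0 ≤ T₁ := by rw [hT₁]; positivity
  have hT₂0 : 0 ≤ T₂ := by rw [hT₂]; positivity
  rw [← hT₁, ← hT₂]
  have hbox : ((latticeBox m (B * q)).card : ℝ) ≤ A₁ * (q : ℝ) ^ m := by
    rw [hA₁]; exact card_latticeBox_mul_le m B hq
  rcases lt_or_ge q q₀ with hqq | hqq
  · have h1 : ‖∑' a, weightedPhase g χ q j a‖ ≤ A₁ * (q : ℝ) ^ m * N := by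
      refine (norm_tsum_le_card_mul _ (latticeBox m (B * q)) (fun a ha => ?_)
        (norm_weightedPhase_le hN q j)).trans (by gcongr)
      by_contra h0
      exact ha (mem_latticeBox_of_weightedPhase_ne_zero hq hχB h0)
    have h2 : (q : ℝ) ≤ q₀ := by exact_mod_cast hqq.le
    calc ‖∑' a, weightedPhase g χ q j a‖ ^ 2 ≤ (A₁ * (q : ℝ) ^ m * N) ^ 2 := by gcongr
      _ = (A₁ * N) ^ 2 * (q : ℝ) ^ m * ((q : ℝ) * 1) ^ m := by ring
      _ ≤ (A₁ * N) ^ 2 * (q₀ : ℝ) ^ m * ((q : ℝ) * j) ^ m := by gcongr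
      _ = (A₁ * N) ^ 2 * (q₀ : ℝ) ^ m * T₁ := by rw [hT₁]
      _ ≤ ((A₁ * N) ^ 2 * q₀ ^ m + A₂ * A₁ * N ^ 2 / c ^ m + A₂ * C * (6 / c) ^ 2 + 1) *
          (T₁ + T₂) := by
        gcongr
        · have : 0 ≤ A₂ * A₁ * N ^ 2 / c ^ m := by positivity
          have : 0 ≤ A₂ * C * (6 / c) ^ 2 := by positivity
          linarith
        · linarith
  obtain ⟨H, hH⟩ : ∃ H : ℕ, H = ⌊c * q / j⌋₊ + 1 := ⟨_, rfl⟩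
  have hH0 : 0 < H := by omega
  have hH0' : (0 : ℝ) < H := by exact_mod_cast hH0
  have hHge : c * q ≤ H * j := by
    have := (Nat.lt_floor_add_one (c * q / j)).le
    rw [div_le_iff₀ (by positivity)] at this
    rw [hH]; push_cast; exact this
  have hHle : (H : ℝ) - 1 ≤ c * q / j := by
    rw [hH]; push_cast
    rw [add_sub_cancel_right]
    exact Nat.floor_le (by positivity)
  have hHq : (H : ℝ) - 1 ≤ q := by
    refine hHle.trans ?_
    rw [div_le_iff₀ (by positivity)]
    nlinarith
  have hHqN : H ≤ q + 1 := by
    have : (H : ℝ) ≤ q + 1 := by linarith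
    exact_mod_cast this
  obtain ⟨i₀, i₁, hi⟩ : ∃ i₀ i₁ : Fin m, i₀ ≠ i₁ :=
    ⟨⟨0, by omega⟩, ⟨1, by omega⟩, by simp⟩
  have hcube : ∀ h ∈ latticeCube m H, ∀ i, 0 ≤ h i ∧ h i < H := fun h hh i =>
    Finset.mem_Ico.mp (Fintype.mem_piFinset.mp hh i)
  have hvdc := card_mul_sq_norm_tsum_le (weightedPhase g χ q j) (latticeCube m H)
    (latticeBox m ((B + 1) * q))
    ⟨0, by simp [latticeCube, hH0]⟩
    (fun h hh b hb => by
      have h1 := mem_latticeBox_of_weightedPhase_ne_zero hq hχB hb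
      rw [latticeBox, Fintype.mem_piFinset] at h1 ⊢
      intro i
      have h2 := Finset.mem_Icc.mp (h1 i)
      have h3 := hcube h hh i
      rw [Pi.add_apply] at h2
      rw [Finset.mem_Icc]
      rw [add_mul, one_mul]
      push_cast at h2 ⊢
      constructor <;> omega)
    (fun k => (if k = 0 then A₁ * (q : ℝ) ^ m * N ^ 2 else 0) +
      C * (q : ℝ) ^ m / j ^ 2 * (recipWeight (k i₀) * recipWeight (k i₁)))
    (A₁ * (q : ℝ) ^ m * N ^ 2 +
      C * (q : ℝ) ^ m / j ^ 2 * ((H : ℝ) ^ m * ((4 + 2 * Real.log H) / H) ^ 2))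
    (fun h hh h' hh' => by
      have hnn : 0 ≤ C * (q : ℝ) ^ m / j ^ 2 *
          (recipWeight ((h - h') i₀) * recipWeight ((h - h') i₁)) :=
        mul_nonneg (by positivity) (mul_nonneg (recipWeight_nonneg _) (recipWeight_nonneg _))
      by_cases hk : h - h' = 0
      · rw [if_pos hk]
        have : ‖∑' a, weightedPhase g χ q j (a + (h - h')) *
            (starRingEnd ℂ) (weightedPhase g χ q j a)‖ ≤ A₁ * (q : ℝ) ^ m * N ^ 2 := by
          refine (norm_tsum_le_card_mul _ (latticeBox m (B * q)) (N := N ^ 2) (fun a ha => ?_)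
            fun a => ?_).trans (by gcongr)
          · by_contra h0
            refine ha (mem_latticeBox_of_weightedPhase_ne_zero (j := j) hq hχB (g := g) fun h1 => ?_)
            simp [h1] at h0
          · rw [norm_mul, RCLike.norm_conj, sq]
            exact mul_le_mul (norm_weightedPhase_le hN q j _) (norm_weightedPhase_le hN q j _)
              (norm_nonneg _) hN0
        linarith
      · rw [if_neg hk, zero_add]
        have hnorm : ‖ratPoint q (h - h')‖ ≤ c / j := by
          rw [pi_norm_le_iff_of_nonneg (by positivity)]
          intro i
          have h1 := hcube h hh i
          have h2 := hcube h' hh' i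
          have h3 : |(h - h') i| ≤ (H : ℤ) - 1 := by
            rw [Pi.sub_apply, abs_le]; constructor <;> omega
          have h4 : |(((h - h') i : ℤ) : ℝ)| ≤ (H : ℝ) - 1 := by exact_mod_cast h3
          rw [ratPoint, Real.norm_eq_abs, abs_div, abs_of_pos hq', div_le_iff₀ hq']
          calc _ ≤ _ := h4
            _ ≤ c * q / j := hHle
            _ = _ := by ring
        have hle : j * ‖ratPoint q (h - h')‖ ≤ c₀ := by
          refine le_trans ?_ hcc₀
          rw [le_div_iff₀ (by positivity)] at hnorm
          linarith
        refine (hcor q hqq hq j hj _ hk hle).trans ?_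
        have h5 := inv_sq_le_recipWeight_mul hq hk i₀ i₁
        calc _ = C * (q : ℝ) ^ m / j ^ 2 * ((q * ‖ratPoint q (h - h')‖) ^ 2)⁻¹ := by
              rw [mul_assoc, mul_pow, div_mul_eq_div_div, div_eq_mul_inv _ (_ ^ 2)]
          _ ≤ _ := by gcongr)
    (fun h' hh' => by
      rw [Finset.sum_add_distrib, ← Finset.mul_sum]
      refine add_le_add ?_ ?_
      · simp only [sub_eq_zero, Finset.sum_ite_eq', if_pos hh']
        exact le_rfl
      · gcongr
        exact sum_latticeCube_recipWeight_le hH0 hi hh')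
  rw [card_latticeCube] at hvdc
  have hbox2 : ((latticeBox m ((B + 1) * q)).card : ℝ) ≤ A₂ * (q : ℝ) ^ m := by
    rw [hA₂]; exact card_latticeBox_mul_le m (B + 1) hq
  have hHm : (0 : ℝ) < (H : ℝ) ^ m := by positivity
  refine le_of_mul_le_mul_left ?_ hHm
  push_cast at hvdc
  refine hvdc.trans ?_
  have hmain1 : A₂ * (q : ℝ) ^ m * (A₁ * (q : ℝ) ^ m * N ^ 2) ≤
      (H : ℝ) ^ m * (A₂ * A₁ * N ^ 2 / c ^ m * T₁) := by
    have : (c * q) ^ m ≤ ((H : ℝ) * j) ^ m := by gcongr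
    calc A₂ * (q : ℝ) ^ m * (A₁ * (q : ℝ) ^ m * N ^ 2)
        = A₂ * A₁ * N ^ 2 * q ^ m / c ^ m * (c * q) ^ m := by
          rw [mul_pow]; field_simp
      _ ≤ A₂ * A₁ * N ^ 2 * q ^ m / c ^ m * ((H : ℝ) * j) ^ m := by gcongr
      _ = _ := by rw [hT₁, mul_pow, mul_pow]; ring
  have hlogH : 4 + 2 * Real.log H ≤ 6 * (1 + Real.log q) := by
    have h1 : Real.log H ≤ Real.log (2 * q) := by
      apply Real.log_le_log hH0'
      linarith
    rw [Real.log_mul (by norm_num) hq'.ne'] at h1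
    have h2 : Real.log 2 ≤ 1 := by
      have := Real.log_le_sub_one_of_pos (show (0 : ℝ) < 2 by norm_num)
      linarith
    linarith
  have hlogH0 : 0 ≤ Real.log H := Real.log_nonneg (by exact_mod_cast hH0)
  have hmain2 : A₂ * (q : ℝ) ^ m * (C * (q : ℝ) ^ m / j ^ 2 *
      ((H : ℝ) ^ m * ((4 + 2 * Real.log H) / H) ^ 2)) ≤
      (H : ℝ) ^ m * (A₂ * C * (6 / c) ^ 2 * T₂) := by
    have h1 : (4 + 2 * Real.log H) / (H * j) ≤ 6 * (1 + Real.log q) / (c * q) := by gcongr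
    have hqm : (q : ℝ) ^ m = q ^ (m - 1) * q := by rw [← pow_succ]; congr 1; omega
    calc _ = A₂ * C * (H : ℝ) ^ m * ((q : ℝ) ^ m * ((4 + 2 * Real.log H) / (H * j))) ^ 2 := by
          field_simp
      _ ≤ A₂ * C * (H : ℝ) ^ m * ((q : ℝ) ^ m * (6 * (1 + Real.log q) / (c * q))) ^ 2 := by gcongr
      _ = _ := by rw [hT₂, hqm]; field_simp
  calc _ ≤ A₂ * (q : ℝ) ^ m * (A₁ * (q : ℝ) ^ m * N ^ 2 +
      C * (q : ℝ) ^ m / j ^ 2 * ((H : ℝ) ^ m * ((4 + 2 * Real.log H) / H) ^ 2)) := by gcongr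
    _ ≤ (H : ℝ) ^ m * (A₂ * A₁ * N ^ 2 / c ^ m * T₁) +
        (H : ℝ) ^ m * (A₂ * C * (6 / c) ^ 2 * T₂) := by linarith
    _ = (H : ℝ) ^ m * (A₂ * A₁ * N ^ 2 / c ^ m * T₁ + A₂ * C * (6 / c) ^ 2 * T₂) := by ring
    _ ≤ _ := by
      gcongr
      have p1 : 0 ≤ A₂ * A₁ * N ^ 2 / c ^ m := by positivity
      have p2 : 0 ≤ A₂ * C * (6 / c) ^ 2 := by positivity
      have p3 : 0 ≤ (A₁ * N) ^ 2 * (q₀ : ℝ) ^ m := by positivity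
      nlinarith [mul_nonneg p1 hT₂0, mul_nonneg p2 hT₁0, mul_nonneg p3 hT₁0, mul_nonneg p3 hT₂0]

lemma unitExp_nat_mul_sub_round (j : ℕ) (θ : ℝ) :
    unitExp (j * (2 * Real.pi * θ)) = unitExp (j * (2 * Real.pi * (θ - round θ))) := by
  rw [unitExp, unitExp, Complex.exp_eq_exp_iff_exists_int]
  exact ⟨j * round θ, by push_cast; ring⟩

/-- The Dirichlet kernel is large near the integers. -/
lemma half_le_norm_sum_unitExp {J : ℕ} {θ : ℝ} (h : J * nint θ ≤ 1 / 16) :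
    (J : ℝ) / 2 ≤ ‖∑ j ∈ Finset.range J, unitExp (j * (2 * Real.pi * θ))‖ := by
  have hpi := Real.pi_lt_four
  have hpi0 := Real.pi_pos
  have h1 : ∀ j ∈ Finset.range J, ‖unitExp (j * (2 * Real.pi * θ)) - 1‖ ≤ 1 / 2 := by
    intro j hj
    have hj' : (j : ℝ) ≤ J := by exact_mod_cast (Finset.mem_range.mp hj).le
    rw [unitExp_nat_mul_sub_round]
    refine (norm_unitExp_sub_one_le _).trans ?_
    rw [abs_mul, abs_mul, abs_of_nonneg (Nat.cast_nonneg j), abs_of_pos (by positivity)]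
    have h2 : (j : ℝ) * |θ - round θ| ≤ 1 / 16 :=
      le_trans (mul_le_mul_of_nonneg_right hj' (abs_nonneg _)) h
    calc (j : ℝ) * (2 * Real.pi * |θ - round θ|) = 2 * Real.pi * (j * |θ - round θ|) := by ring
      _ ≤ 2 * 4 * (1 / 16) := by gcongr
      _ = 1 / 2 := by norm_num
  have h2 : ‖∑ j ∈ Finset.range J, (unitExp (j * (2 * Real.pi * θ)) - 1)‖ ≤ J * (1 / 2) := by
    refine (norm_sum_le_of_le _ h1).trans ?_
    simp
  rw [Finset.sum_sub_distrib] at h2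
  have h3 := norm_sub_norm_le (∑ j ∈ Finset.range J, (1 : ℂ))
    (∑ j ∈ Finset.range J, unitExp (j * (2 * Real.pi * θ)))
  rw [norm_sub_rev] at h3
  simp only [Finset.sum_const, Finset.card_range, nsmul_eq_mul, mul_one,
    Complex.norm_natCast] at h2 h3
  linarith

/-- A weighted mean square of Dirichlet kernels in terms of exponential sums. -/
lemma sum_mul_sq_norm_sum_unitExp_le {α : Type*} (s : Finset α) {ψ : α → ℝ} (hψ : ∀ a, 0 ≤ ψ a)
    (θ : α → ℝ) (J : ℕ) {M : ℝ} (hM0 : 0 ≤ M)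
    (hM : ∀ k, 1 ≤ k → k < J → ‖∑ a ∈ s, (ψ a : ℂ) * unitExp (k * θ a)‖ ≤ M) :
    ∑ a ∈ s, ψ a * ‖∑ j ∈ Finset.range J, unitExp (j * θ a)‖ ^ 2 ≤
      J * ∑ a ∈ s, ψ a + J ^ 2 * M := by
  have e : ((∑ a ∈ s, ψ a * ‖∑ j ∈ Finset.range J, unitExp (j * θ a)‖ ^ 2 : ℝ) : ℂ) =
      ∑ j ∈ Finset.range J, ∑ j' ∈ Finset.range J,
        ∑ a ∈ s, (ψ a : ℂ) * (unitExp (j * θ a) * (starRingEnd ℂ) (unitExp (j' * θ a))) := by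
    push_cast
    have : ∀ a ∈ s, (ψ a : ℂ) * (‖∑ j ∈ Finset.range J, unitExp (j * θ a)‖ : ℂ) ^ 2 =
        ∑ j ∈ Finset.range J, ∑ j' ∈ Finset.range J,
          (ψ a : ℂ) * (unitExp (j * θ a) * (starRingEnd ℂ) (unitExp (j' * θ a))) := by
      intro a _
      rw [← Complex.mul_conj', map_sum, Finset.sum_mul_sum, Finset.mul_sum]
      simp_rw [Finset.mul_sum]
    rw [Finset.sum_congr rfl this, Finset.sum_comm]
    exact Finset.sum_congr rfl fun j _ => Finset.sum_comm
  have hψs : 0 ≤ ∑ a ∈ s, ψ a := Finset.sum_nonneg fun a _ => hψ a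
  have hterm : ∀ j ∈ Finset.range J, ∀ j' ∈ Finset.range J,
      ‖∑ a ∈ s, (ψ a : ℂ) * (unitExp (j * θ a) * (starRingEnd ℂ) (unitExp (j' * θ a)))‖ ≤
        (if j = j' then ∑ a ∈ s, ψ a else 0) + M := by
    intro j hj j' hj'
    rw [Finset.mem_range] at hj hj'
    rcases lt_trichotomy j j' with h | h | h
    · rw [if_neg h.ne, zero_add, ← RCLike.norm_conj, map_sum]
      refine le_of_eq_of_le ?_ (hM (j' - j) (by omega) (by omega))
      congr 1
      refine Finset.sum_congr rfl fun a _ => ?_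
      rw [map_mul, map_mul, Complex.conj_conj, Complex.conj_ofReal, conj_unitExp, ← unitExp_add,
        Nat.cast_sub h.le]
      ring_nf
    · subst h
      rw [if_pos rfl]
      refine le_trans ?_ (le_add_of_nonneg_right hM0)
      refine (norm_sum_le _ _).trans (Finset.sum_le_sum fun a _ => ?_)
      rw [norm_mul, norm_mul, RCLike.norm_conj, norm_unitExp, Complex.norm_real,
        Real.norm_of_nonneg (hψ a), mul_one, mul_one]
    · rw [if_neg h.ne', zero_add]
      refine le_of_eq_of_le ?_ (hM (j - j') (by omega) (by omega))
      congr 1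
      refine Finset.sum_congr rfl fun a _ => ?_
      rw [conj_unitExp, ← unitExp_add, Nat.cast_sub h.le]
      ring_nf
  have hnn : 0 ≤ ∑ a ∈ s, ψ a * ‖∑ j ∈ Finset.range J, unitExp (j * θ a)‖ ^ 2 :=
    Finset.sum_nonneg fun a _ => mul_nonneg (hψ a) (by positivity)
  rw [← Real.norm_of_nonneg hnn, ← Complex.norm_real, e]
  refine (norm_sum_le_of_le _ fun j hj => norm_sum_le_of_le _ fun j' hj' =>
    hterm j hj j' hj').trans (le_of_eq ?_)
  simp only [Finset.sum_add_distrib, Finset.sum_ite_eq, Finset.sum_const, Finset.card_range,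
    nsmul_eq_mul, Finset.sum_ite_mem, Finset.inter_self]
  ring

/-- Counting points whose phase is near an integer through exponential sums. -/
lemma card_mul_le_of_norm_sum_unitExp_le {α : Type*} (s t : Finset α) (hts : t ⊆ s) {ψ : α → ℝ}
    (hψ : ∀ a, 0 ≤ ψ a) (hψt : ∀ a ∈ t, 1 ≤ ψ a) (θ : α → ℝ) {J : ℕ} (hJ : 0 < J)
    (ht : ∀ a ∈ t, J * nint (θ a) ≤ 1 / 16) {M : ℝ} (hM0 : 0 ≤ M)
    (hM : ∀ k, 1 ≤ k → k < J →
      ‖∑ a ∈ s, (ψ a : ℂ) * unitExp (k * (2 * Real.pi * θ a))‖ ≤ M) :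
    (t.card : ℝ) ≤ 4 * ((∑ a ∈ s, ψ a) / J + M) := by
  have hJ' : (0 : ℝ) < J := by exact_mod_cast hJ
  have h1 := sum_mul_sq_norm_sum_unitExp_le s hψ (fun a => 2 * Real.pi * θ a) J hM0 hM
  have h2 : (t.card : ℝ) * (J / 2) ^ 2 ≤
      ∑ a ∈ s, ψ a * ‖∑ j ∈ Finset.range J, unitExp (j * (2 * Real.pi * θ a))‖ ^ 2 := by
    rw [← nsmul_eq_mul]
    refine (Finset.card_nsmul_le_sum _ _ _ fun a ha => ?_).trans
      (Finset.sum_le_sum_of_subset_of_nonneg hts fun a _ _ => mul_nonneg (hψ a) (by positivity))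
    have h3 := half_le_norm_sum_unitExp (ht a ha)
    calc ((J : ℝ) / 2) ^ 2 = 1 * (J / 2) ^ 2 := (one_mul _).symm
      _ ≤ _ := mul_le_mul (hψt a ha) (by gcongr) (by positivity) (hψ a)
  have h4 : (t.card : ℝ) * (J / 2) ^ 2 ≤ (4 * ((∑ a ∈ s, ψ a) / J + M)) * (J / 2) ^ 2 := by
    refine (h2.trans h1).trans (le_of_eq ?_)
    field_simp
    ring
  exact le_of_mul_le_mul_right h4 (by positivity)

lemma hess_const_mul {m : ℕ} {F : (Fin m → ℝ) → ℝ} (hF : ContDiff ℝ 2 F) (c : ℝ)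
    (x : Fin m → ℝ) : hess (fun y => c * F y) x = c • hess F x := by
  ext i j
  have h1 : ∀ y, fderiv ℝ (fun y => c * F y) y = c • fderiv ℝ F y := fun y =>
    fderiv_const_mul (hF.differentiable (by simp) y) c
  have h2 : Differentiable ℝ (fun y => fderiv ℝ F y (Pi.single j 1)) :=
    ((hF.fderiv_right (m := 1) (by norm_num)).differentiable (by simp)).clm_apply
      (differentiable_const _)
  simp only [hess, Matrix.of_apply, Matrix.smul_apply, h1, smul_apply,
    smul_eq_mul]
  rw [fderiv_const_mul (h2 x)]
  simp

lemma one_add_log_le_mul_rpow {ε : ℝ} (hε : 0 < ε) {x : ℝ} (hx : 1 ≤ x) :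
    1 + Real.log x ≤ (1 + 1 / ε) * x ^ ε := by
  have h1 := Real.log_le_rpow_div (by linarith : 0 ≤ x) hε
  have h2 : 1 ≤ x ^ ε := Real.one_le_rpow hx hε.le
  calc 1 + Real.log x ≤ x ^ ε + x ^ ε / ε := add_le_add h2 h1
    _ = _ := by ring

/-- Local count of rational points with a given denominator near a hypersurface, close to a point
where the Hessian is nondegenerate. -/
lemma exists_card_ratPoint_le {m : ℕ} (hm : 2 ≤ m) {F : (Fin m → ℝ) → ℝ}
    (hF : ContDiff ℝ (4 : ℕ) F) (hFc : HasCompactSupport F) (x₀ : Fin m → ℝ)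
    (hdet : (hess F x₀).det ≠ 0) :
    ∃ r > (0 : ℝ), ∃ C > (0 : ℝ), ∀ q : ℕ, 0 < q → ∀ δ : ℝ, 0 < δ → ∀ t : Finset (Fin m → ℤ),
      (∀ a ∈ t, ‖ratPoint q a - x₀‖ < r ∧ nint (q * F (ratPoint q a)) < δ) →
      (t.card : ℝ) ≤ C * (δ * (q : ℝ) ^ m + (q : ℝ) ^ ((m : ℝ) - m / (m + 2))) := by
  have hpi := Real.pi_pos
  obtain ⟨r, hr, hE⟩ := exists_sq_norm_tsum_weightedPhase_le hm
    (g := fun x => 2 * Real.pi * F x) (contDiff_const.mul hF) (hFc.mul_left) x₀ (by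
      rw [hess_const_mul (hF.of_le (by norm_cast)), Matrix.det_smul]
      exact mul_ne_zero (by positivity) hdet)
  let χ : ContDiffBump x₀ := ⟨r / 4, r / 2, by positivity, by linarith⟩
  obtain ⟨C, hC, hS⟩ := hE χ χ.contDiff (fun x hx => by
    have : x ∈ Function.support χ := hx
    rw [χ.support_eq, mem_ball_iff_norm] at this
    exact this.trans (by change r / 2 < r; linarith))
  obtain ⟨B, hB⟩ := exists_nat_ge (‖x₀‖ + r)
  obtain ⟨A, hA⟩ : ∃ A : ℝ, A = (2 * B + 1) ^ m := ⟨_, rfl⟩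
  have hA0 : 0 < A := by rw [hA]; positivity
  obtain ⟨κ, hκ⟩ : ∃ κ : ℝ, κ = m / (m + 2) := ⟨_, rfl⟩
  obtain ⟨K, hK⟩ : ∃ K : ℝ, K = 1 + 1 / (2 / ((m : ℝ) + 2)) := ⟨_, rfl⟩
  have hK0 : 0 < K := by rw [hK]; positivity
  have hm2 : (0 : ℝ) < m + 2 := by positivity
  refine ⟨r / 4, by positivity, 128 * A + 4 * √(C * (1 + K ^ 2)), by positivity, ?_⟩
  intro q hq δ hδ t ht
  have hq' : (0 : ℝ) < q := by exact_mod_cast hq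
  have hq1 : (1 : ℝ) ≤ q := by exact_mod_cast hq
  rw [← hκ]
  have hbox : ((latticeBox m (B * q)).card : ℝ) ≤ A * (q : ℝ) ^ m := by
    rw [hA]; exact card_latticeBox_mul_le m B hq
  have hnear : ∀ a, ‖ratPoint q a - x₀‖ < r → a ∈ latticeBox m (B * q) := fun a ha => by
    refine mem_latticeBox_of_norm_ratPoint_le hq ?_
    have h2 := norm_add_le (ratPoint q a - x₀) x₀
    rw [sub_add_cancel] at h2
    linarith
  have hts : t ⊆ latticeBox m (B * q) := fun a ha => hnear a ((ht a ha).1.trans (by linarith))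
  obtain ⟨δ', hδ'⟩ : ∃ δ' : ℝ, δ' = max δ ((q : ℝ) ^ (-κ)) := ⟨_, rfl⟩
  have hδ'0 : 0 < δ' := hδ' ▸ lt_max_of_lt_left hδ
  have hδδ' : δ ≤ δ' := hδ' ▸ le_max_left _ _
  have hqδ' : (q : ℝ) ^ (-κ) ≤ δ' := hδ' ▸ le_max_right _ _
  have hqm : (q : ℝ) ^ (-κ) * (q : ℝ) ^ m = (q : ℝ) ^ ((m : ℝ) - κ) := by
    rw [← Real.rpow_natCast, ← Real.rpow_add hq']; ring_nf
  have hδ'm : δ' * (q : ℝ) ^ m ≤ δ * (q : ℝ) ^ m + (q : ℝ) ^ ((m : ℝ) - κ) := by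
    rw [← hqm, ← add_mul, hδ']
    gcongr
    exact max_le_add_of_nonneg hδ.le (by positivity)
  have hα0 : 0 ≤ (q : ℝ) ^ ((m : ℝ) - κ) := by positivity
  have hδm0 : 0 ≤ δ * (q : ℝ) ^ m := by positivity
  suffices h : (t.card : ℝ) ≤ 128 * A * (δ' * (q : ℝ) ^ m) +
      4 * (√(C * (1 + K ^ 2)) * (q : ℝ) ^ ((m : ℝ) - κ)) by
    refine h.trans ?_
    have h1 := mul_le_mul_of_nonneg_left hδ'm (by positivity : 0 ≤ 128 * A)
    have h2 : 0 ≤ √(C * (1 + K ^ 2)) * (δ * (q : ℝ) ^ m) := by positivity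
    linarith
  have hlast : 0 ≤ 4 * (√(C * (1 + K ^ 2)) * (q : ℝ) ^ ((m : ℝ) - κ)) := by positivity
  rcases lt_or_ge (1 / 16) δ' with hbig | hsmall
  · have h1 : (t.card : ℝ) ≤ A * (q : ℝ) ^ m :=
      le_trans (by exact_mod_cast Finset.card_le_card hts) hbox
    have h2 : 0 < A * (q : ℝ) ^ m := by positivity
    nlinarith
  obtain ⟨J, hJ⟩ : ∃ J : ℕ, J = ⌊1 / (16 * δ')⌋₊ := ⟨_, rfl⟩
  have hJle : (J : ℝ) ≤ 1 / (16 * δ') := hJ ▸ Nat.floor_le (by positivity)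
  have hJ1 : 1 ≤ J := by
    rw [hJ, Nat.one_le_floor_iff, le_div_iff₀ (by positivity)]
    linarith
  have hJ1' : (1 : ℝ) ≤ J := by exact_mod_cast hJ1
  have hJge : 1 / (16 * δ') ≤ 2 * J := by
    have := (Nat.lt_floor_add_one (1 / (16 * δ'))).le
    rw [← hJ] at this
    linarith
  have hJδ : J * δ' ≤ 1 / 16 := by
    rw [le_div_iff₀ (by positivity)] at hJle
    linarith
  have hJq : (J : ℝ) ≤ (q : ℝ) ^ κ := by
    have h1 : J * (q : ℝ) ^ (-κ) ≤ 1 := by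
      have : J * (q : ℝ) ^ (-κ) ≤ J * δ' := by gcongr
      linarith
    rw [Real.rpow_neg hq'.le, ← div_eq_mul_inv, div_le_one (by positivity)] at h1
    exact h1
  have hχ0 : ∀ a, 0 ≤ χ (ratPoint q a) := fun a => χ.nonneg
  have hM : ∀ k, 1 ≤ k → k < J → ‖∑ a ∈ latticeBox m (B * q), (χ (ratPoint q a) : ℂ) *
      unitExp (k * (2 * Real.pi * (q * F (ratPoint q a))))‖ ≤
      √(C * (1 + K ^ 2)) * (q : ℝ) ^ ((m : ℝ) - κ) := by
    intro k hk1 hkJ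
    have h1 := hS q hq k hk1
    rw [tsum_eq_sum (s := latticeBox m (B * q)) (fun a ha => by
      have : χ (ratPoint q a) = 0 := by
        by_contra h0
        refine ha (hnear a ?_)
        have h3 : ratPoint q a ∈ Function.support χ := h0
        rw [χ.support_eq, mem_ball_iff_norm] at h3
        exact h3.trans (by change r / 2 < r; linarith)
      simp [weightedPhase, this])] at h1
    have h2 : ∀ a, weightedPhase (fun x => 2 * Real.pi * F x) χ q k a =
        (χ (ratPoint q a) : ℂ) * unitExp (k * (2 * Real.pi * (q * F (ratPoint q a)))) := by
      intro a
      rw [weightedPhase]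
      congr 2
      ring
    simp only [h2] at h1
    have hkJ' : (k : ℝ) ≤ (q : ℝ) ^ κ := le_trans (by exact_mod_cast hkJ.le) hJq
    have h3 : ((q : ℝ) * k) ^ m ≤ ((q : ℝ) ^ ((m : ℝ) - κ)) ^ 2 := by
      calc ((q : ℝ) * k) ^ m ≤ ((q : ℝ) * (q : ℝ) ^ κ) ^ m := by gcongr
        _ = ((q : ℝ) ^ (1 + κ)) ^ m := by rw [Real.rpow_add hq', Real.rpow_one]
        _ = (q : ℝ) ^ ((1 + κ) * m) := by rw [Real.rpow_mul_natCast hq'.le]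
        _ = (q : ℝ) ^ (((m : ℝ) - κ) * (2 : ℕ)) := by
          congr 1
          rw [hκ]; push_cast; field_simp; ring
        _ = _ := by rw [Real.rpow_mul_natCast hq'.le]
    have h4 : (q : ℝ) ^ (m - 1) * (1 + Real.log q) ≤ K * (q : ℝ) ^ ((m : ℝ) - κ) := by
      have h5 := one_add_log_le_mul_rpow (by positivity : 0 < 2 / ((m : ℝ) + 2)) hq1
      calc (q : ℝ) ^ (m - 1) * (1 + Real.log q)
          ≤ (q : ℝ) ^ (m - 1) * (K * (q : ℝ) ^ (2 / ((m : ℝ) + 2))) := by rw [hK]; gcongr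
        _ = K * ((q : ℝ) ^ (((m - 1 : ℕ) : ℝ)) * (q : ℝ) ^ (2 / ((m : ℝ) + 2))) := by
          rw [Real.rpow_natCast]; ring
        _ = _ := by
          rw [← Real.rpow_add hq', Nat.cast_sub (by omega), hκ]
          congr 2
          field_simp
          push_cast
          ring
    have hlog : 0 ≤ Real.log q := Real.log_nonneg hq1
    have h6 : ‖∑ a ∈ latticeBox m (B * q), (χ (ratPoint q a) : ℂ) *
        unitExp (k * (2 * Real.pi * (q * F (ratPoint q a))))‖ ^ 2 ≤
        (C * (1 + K ^ 2)) * ((q : ℝ) ^ ((m : ℝ) - κ)) ^ 2 := by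
      refine h1.trans ?_
      rw [mul_assoc]
      gcongr
      calc _ ≤ ((q : ℝ) ^ ((m : ℝ) - κ)) ^ 2 + (K * (q : ℝ) ^ ((m : ℝ) - κ)) ^ 2 := by gcongr
        _ = _ := by ring
    refine abs_le_of_sq_le_sq' ?_ (by positivity) |>.2
    rw [mul_pow, Real.sq_sqrt (by positivity)]
    exact h6
  have hcount := card_mul_le_of_norm_sum_unitExp_le (latticeBox m (B * q)) t hts hχ0
    (fun a ha => by
      refine (χ.one_of_mem_closedBall ?_).ge
      rw [mem_closedBall_iff_norm]
      exact (ht a ha).1.le)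
    (fun a => q * F (ratPoint q a)) hJ1
    (fun a ha => by
      have h1 := (ht a ha).2.le.trans hδδ'
      calc (J : ℝ) * _ ≤ J * δ' := by gcongr
        _ ≤ _ := hJδ) (by positivity) hM
  refine hcount.trans ?_
  have h1 : ∑ a ∈ latticeBox m (B * q), χ (ratPoint q a) ≤ A * (q : ℝ) ^ m := by
    refine le_trans ?_ hbox
    rw [← nsmul_one]
    exact Finset.sum_le_card_nsmul _ _ _ fun a _ => χ.le_one
  have h2 : (∑ a ∈ latticeBox m (B * q), χ (ratPoint q a)) / J ≤ 32 * A * (δ' * (q : ℝ) ^ m) := by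
    rw [div_le_iff₀ (by positivity)]
    rw [div_le_iff₀ (by positivity)] at hJge
    refine h1.trans ?_
    have : 0 ≤ A * (q : ℝ) ^ m := by positivity
    nlinarith
  linarith

/-- The local count for a function that is smooth on an open set only. -/
lemma exists_card_ratPoint_le_of_contDiffOn {m : ℕ} (hm : 2 ≤ m) {D : Set (Fin m → ℝ)}
    (hD : IsOpen D) {f : (Fin m → ℝ) → ℝ} (hf : ContDiffOn ℝ (4 : ℕ) f D) {x₀ : Fin m → ℝ}
    (hx₀ : x₀ ∈ D) (hdet : (hess f x₀).det ≠ 0) :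
    ∃ r > (0 : ℝ), ∃ C > (0 : ℝ), ∀ q : ℕ, 0 < q → ∀ δ : ℝ, 0 < δ → ∀ t : Finset (Fin m → ℤ),
      (∀ a ∈ t, ‖ratPoint q a - x₀‖ < r ∧ nint (q * f (ratPoint q a)) < δ) →
      (t.card : ℝ) ≤ C * (δ * (q : ℝ) ^ m + (q : ℝ) ^ ((m : ℝ) - m / (m + 2))) := by
  obtain ⟨ρ, hρ, hρD⟩ := Metric.nhds_basis_closedBall.mem_iff.mp (hD.mem_nhds hx₀)
  let b : ContDiffBump x₀ := ⟨ρ / 2, ρ, by positivity, by linarith⟩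
  have hbD : tsupport b ⊆ D := by rw [b.tsupport_eq]; exact hρD
  have hF : ContDiff ℝ (4 : ℕ) (fun x => b x * f x) := by
    refine contDiff_iff_contDiffAt.mpr fun x => ?_
    by_cases hx : x ∈ tsupport b
    · exact b.contDiff.contDiffAt.mul (hf.contDiffAt (hD.mem_nhds (hbD hx)))
    · refine (contDiffAt_const (c := (0 : ℝ))).congr_of_eventuallyEq ?_
      filter_upwards [notMem_tsupport_iff_eventuallyEq.mp hx] with y hy
      simp [hy]
  have heq : (fun x => b x * f x) =ᶠ[nhds x₀] f := by
    filter_upwards [b.eventuallyEq_one] with x hx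
    simp [hx]
  have hhess : hess (fun x => b x * f x) x₀ = hess f x₀ := by
    ext i j
    simp only [hess, Matrix.of_apply]
    have : (fun y => fderiv ℝ (fun x => b x * f x) y (Pi.single j 1)) =ᶠ[nhds x₀]
        fun y => fderiv ℝ f y (Pi.single j 1) := by
      filter_upwards [heq.fderiv (𝕜 := ℝ)] with y hy
      rw [hy]
    rw [this.fderiv_eq]
  obtain ⟨r, hr, C, hC, h⟩ := exists_card_ratPoint_le hm hF b.hasCompactSupport.mul_right x₀
    (hhess ▸ hdet)
  refine ⟨min r (ρ / 2), by positivity, C, hC, fun q hq δ hδ t ht => h q hq δ hδ t fun a ha => ?_⟩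
  obtain ⟨h1, h2⟩ := ht a ha
  refine ⟨h1.trans_le (min_le_left _ _), ?_⟩
  rw [b.one_of_mem_closedBall, one_mul]
  · exact h2
  · rw [mem_closedBall_iff_norm]
    exact h1.le.trans (min_le_right _ _)

/-- The count over a compact set where the Hessian is nondegenerate. -/
lemma exists_card_ratPoint_le_of_isCompact {m : ℕ} (hm : 2 ≤ m) {D : Set (Fin m → ℝ)}
    (hD : IsOpen D) {f : (Fin m → ℝ) → ℝ} (hf : ContDiffOn ℝ (4 : ℕ) f D)
    (hdet : ∀ x ∈ D, (hess f x).det ≠ 0) {K : Set (Fin m → ℝ)} (hK : IsCompact K) (hKD : K ⊆ D) :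
    ∃ C > (0 : ℝ), ∀ q : ℕ, 0 < q → ∀ δ : ℝ, 0 < δ → ∀ t : Finset (Fin m → ℤ),
      (∀ a ∈ t, ratPoint q a ∈ K ∧ nint (q * f (ratPoint q a)) < δ) →
      (t.card : ℝ) ≤ C * (δ * (q : ℝ) ^ m + (q : ℝ) ^ ((m : ℝ) - m / (m + 2))) := by
  classical
  refine hK.induction_on (p := fun s => ∃ C > (0 : ℝ), ∀ q : ℕ, 0 < q → ∀ δ : ℝ, 0 < δ →
    ∀ t : Finset (Fin m → ℤ), (∀ a ∈ t, ratPoint q a ∈ s ∧ nint (q * f (ratPoint q a)) < δ) →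
      (t.card : ℝ) ≤ C * (δ * (q : ℝ) ^ m + (q : ℝ) ^ ((m : ℝ) - m / (m + 2)))) ?_ ?_ ?_ ?_
  · refine ⟨1, one_pos, fun q hq δ hδ t ht => ?_⟩
    have : t = ∅ := Finset.eq_empty_of_forall_notMem fun a ha => (ht a ha).1
    rw [this, Finset.card_empty, Nat.cast_zero]
    positivity
  · rintro s s' hs ⟨C, hC, h⟩
    exact ⟨C, hC, fun q hq δ hδ t ht => h q hq δ hδ t fun a ha => ⟨hs (ht a ha).1, (ht a ha).2⟩⟩
  · rintro s s' ⟨C, hC, h⟩ ⟨C', hC', h'⟩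
    refine ⟨C + C', by positivity, fun q hq δ hδ t ht => ?_⟩
    have h1 := h q hq δ hδ (t.filter fun a => ratPoint q a ∈ s) fun a ha => by
      rw [Finset.mem_filter] at ha
      exact ⟨ha.2, (ht a ha.1).2⟩
    have h2 := h' q hq δ hδ (t.filter fun a => ratPoint q a ∉ s) fun a ha => by
      rw [Finset.mem_filter] at ha
      exact ⟨(ht a ha.1).1.resolve_left ha.2, (ht a ha.1).2⟩
    rw [← Finset.card_filter_add_card_filter_not (s := t) (fun a => ratPoint q a ∈ s), add_mul]
    push_cast
    exact add_le_add h1 h2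
  · intro x hx
    obtain ⟨r, hr, C, hC, h⟩ :=
      exists_card_ratPoint_le_of_contDiffOn hm hD hf (hKD hx) (hdet x (hKD hx))
    refine ⟨Metric.ball x r, mem_nhdsWithin_of_mem_nhds (Metric.ball_mem_nhds x hr), C, hC,
      fun q hq δ hδ t ht => h q hq δ hδ t fun a ha => ⟨?_, (ht a ha).2⟩⟩
    rw [← mem_ball_iff_norm]
    exact (ht a ha).1

lemma finsum_le_card_mul {α : Type*} {φ : α → ℝ} (hφ : φ.HasFiniteSupport) {W : ℝ}
    (hW : ∀ a, φ a ≤ W) : ∑ᶠ a, φ a ≤ hφ.toFinset.card * W := by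
  rw [finsum_eq_sum φ hφ, ← nsmul_eq_mul]
  exact Finset.sum_le_card_nsmul _ _ _ fun a _ => hW a

/-- Bound for the weighted count in terms of the dimension of the parameter space. -/
lemma exists_NSw_le {m : ℕ} (hm : 2 ≤ m) {D : Set (Fin m → ℝ)} (hD : IsOpen D)
    {f : (Fin m → ℝ) → ℝ} (hf : ContDiffOn ℝ (4 : ℕ) f D) (hdet : ∀ x ∈ D, (hess f x).det ≠ 0)
    {w : (Fin m → ℝ) → ℝ} (hw : Continuous w) (hwc : HasCompactSupport w) (hwD : tsupport w ⊆ D) :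
    ∃ C > (0 : ℝ), ∀ Q δ : ℝ, 1 ≤ Q → 0 < δ →
      NSw f w Q δ ≤ C * (δ * Q ^ (m + 1) + Q ^ ((m : ℝ) - m / (m + 2) + 1)) := by
  obtain ⟨C, hC, hcount⟩ := exists_card_ratPoint_le_of_isCompact hm hD hf hdet hwc hwD
  obtain ⟨W, hW⟩ := hw.bounded_above_of_compact_support hwc
  have hW0 : 0 ≤ W := (norm_nonneg _).trans (hW 0)
  obtain ⟨B, hB⟩ : ∃ B : ℕ, ∀ x, w x ≠ 0 → ‖x‖ ≤ B := by
    obtain ⟨R, hR⟩ := hwc.isBounded.exists_norm_le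
    obtain ⟨B, hB⟩ := exists_nat_ge R
    exact ⟨B, fun x hx => (hR x (subset_tsupport w hx)).trans hB⟩
  have hα : 0 ≤ (m : ℝ) - m / (m + 2) := by
    rw [sub_nonneg, div_le_iff₀ (by positivity)]
    have : (0 : ℝ) ≤ m := Nat.cast_nonneg m
    nlinarith
  refine ⟨C * W + 1, by positivity, fun Q δ hQ hδ => ?_⟩
  obtain ⟨I, hI⟩ : ∃ I : ℤ → ℝ, I = fun q : ℤ => ∑ᶠ a : Fin m → ℤ,
      if 1 ≤ q ∧ (q : ℝ) ≤ Q ∧ nint ((q : ℝ) * f (fun i => (a i : ℝ) / (q : ℝ))) < δ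
      then w (fun i => (a i : ℝ) / (q : ℝ)) else 0 := ⟨_, rfl⟩
  have hI0 : ∀ q : ℤ, q ∉ Finset.Icc (1 : ℤ) ⌊Q⌋ → I q = 0 := by
    intro q hq
    rw [hI]
    refine finsum_eq_zero_of_forall_eq_zero fun a => if_neg fun h => hq ?_
    exact Finset.mem_Icc.mpr ⟨h.1, Int.le_floor.mpr h.2.1⟩
  have hIle : ∀ q ∈ Finset.Icc (1 : ℤ) ⌊Q⌋,
      I q ≤ C * W * (δ * Q ^ m + Q ^ ((m : ℝ) - m / (m + 2))) := by
    intro q hq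
    rw [Finset.mem_Icc, Int.le_floor] at hq
    obtain ⟨k, rfl⟩ := Int.eq_ofNat_of_zero_le (by omega : 0 ≤ q)
    have hk : 0 < k := by omega
    have hkQ : (k : ℝ) ≤ Q := by exact_mod_cast hq.2
    simp only [hI, Int.cast_natCast]
    have hmem : ∀ a : Fin m → ℤ, (if 1 ≤ (k : ℤ) ∧ (k : ℝ) ≤ Q ∧ nint (k * f (ratPoint k a)) < δ
        then w (ratPoint k a) else 0) ≠ 0 →
        w (ratPoint k a) ≠ 0 ∧ nint (k * f (ratPoint k a)) < δ := by
      intro a ha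
      rw [ne_eq, ite_eq_right_iff, Classical.not_imp] at ha
      exact ⟨ha.2, ha.1.2.2⟩
    have hfin : (fun a : Fin m → ℤ => if 1 ≤ (k : ℤ) ∧ (k : ℝ) ≤ Q ∧
        nint (k * f (ratPoint k a)) < δ then w (ratPoint k a) else 0).HasFiniteSupport :=
      Set.Finite.subset (latticeBox m (B * k)).finite_toSet fun a ha =>
        mem_latticeBox_of_norm_ratPoint_le hk (hB _ (hmem a ha).1)
    refine (finsum_le_card_mul hfin (W := W) fun a => ?_).trans ?_
    · split_ifs
      · exact (le_abs_self _).trans (hW _)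
      · exact hW0
    · have h1 := hcount k hk δ hδ hfin.toFinset fun a ha => by
        have h2 := hmem a (hfin.mem_toFinset.mp ha)
        exact ⟨subset_tsupport w h2.1, h2.2⟩
      calc _ ≤ C * (δ * (k : ℝ) ^ m + (k : ℝ) ^ ((m : ℝ) - m / (m + 2))) * W := by gcongr
        _ ≤ C * (δ * Q ^ m + Q ^ ((m : ℝ) - m / (m + 2))) * W := by gcongr
        _ = _ := by ring
  have hN : NSw f w Q δ = ∑ᶠ q, I q := by rw [hI]; rfl
  rw [hN, finsum_eq_sum_of_support_subset (s := Finset.Icc (1 : ℤ) ⌊Q⌋) I fun q hq => by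
    by_contra h
    exact hq (hI0 q h)]
  refine (Finset.sum_le_card_nsmul _ _ _ hIle).trans ?_
  have hQ0 : 0 < Q := by linarith
  have hcard : ((Finset.Icc (1 : ℤ) ⌊Q⌋).card : ℝ) ≤ Q := by
    rw [Int.card_Icc, add_sub_cancel_right]
    have h1 : 0 ≤ ⌊Q⌋ := Int.floor_nonneg.mpr hQ0.le
    have h2 : ((⌊Q⌋.toNat : ℤ) : ℝ) = (⌊Q⌋ : ℝ) := by rw [Int.toNat_of_nonneg h1]
    rw [Int.cast_natCast] at h2
    rw [h2]
    exact Int.floor_le Q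
  rw [nsmul_eq_mul, Real.rpow_add_one hQ0.ne', pow_succ]
  have hnn : 0 ≤ δ * Q ^ m + Q ^ ((m : ℝ) - m / (m + 2)) := by positivity
  calc _ ≤ Q * (C * W * (δ * Q ^ m + Q ^ ((m : ℝ) - m / (m + 2)))) := by gcongr
    _ ≤ Q * ((C * W + 1) * (δ * Q ^ m + Q ^ ((m : ℝ) - m / (m + 2)))) := by gcongr; linarith
    _ = _ := by ring

theorem statement12 (n : ℕ) (hn : 3 ≤ n) (l : ℕ)
    (hl : l = max ((n - 1) / 2 + 5) (n + 1))
    (D : Set (Fin (n - 1) → ℝ)) (hDopen : IsOpen D)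
    (hDbdd : Bornology.IsBounded D) (hDconn : IsConnected D)
    (f : (Fin (n - 1) → ℝ) → ℝ) (hf : ContDiffOn ℝ (l : ℕ∞) f D)
    (c₁ c₂ : ℝ) (hc₁ : 0 < c₁)
    (hHess : ∀ x ∈ D, c₁ ≤ |(hess f x).det| ∧ |(hess f x).det| ≤ c₂)
    -- `∇f : D → ∇f(D)` is a diffeomorphism
    (hdiffeo : Set.InjOn (gradv f) D)
    (w : (Fin (n - 1) → ℝ) → ℝ) (hw : ContDiff ℝ (⊤ : ℕ∞) w)
    (hwc : HasCompactSupport w) (hwD : tsupport w ⊆ D) :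
    ∃ C > (0 : ℝ), ∀ Q δ : ℝ, 2 ≤ Q → 0 < δ → δ < 1 / 2 →
      NSw f w Q δ ≤ C * (δ * Q ^ n + Q ^ ((n : ℝ) - 1 + 2 / ((n : ℝ) + 1))) := by
  have hm : ((n - 1 : ℕ) : ℝ) = n - 1 := by rw [Nat.cast_sub (by omega), Nat.cast_one]
  have h4l : 4 ≤ l := by rw [hl]; exact le_max_of_le_left (by omega)
  obtain ⟨C, hC, h⟩ := exists_NSw_le (by omega : 2 ≤ n - 1) hDopen
    (hf.of_le (WithTop.coe_le_coe.mpr (Nat.cast_le.mpr h4l)))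
    (fun x hx => abs_pos.mp (hc₁.trans_le (hHess x hx).1)) hw.continuous hwc hwD
  refine ⟨C, hC, fun Q δ hQ hδ _ => (h Q δ (by linarith) hδ).trans_eq ?_⟩
  have hn1 : (0 : ℝ) < n + 1 := by positivity
  rw [show n - 1 + 1 = n by omega, hm, show (n : ℝ) - 1 + 2 = n + 1 by ring]
  congr 3
  field_simp
  ring
end

section
/- Define the sequence β₁ = n and β_i = n − (n−1)/(2β_{i−1} − n + 1) for i ≥ 2. Then β_i − (n−1) = (β_{i−1} − (n−1))/(β_{i−1} − (n−1)/2) for all i ≥ 2; when n = 3 one has β_i = 2 + 1/i for all i ≥ 1; and when n ≥ 4 one has β_i − (n−1) ≤ (2/3)^{i−1} for all i ≥ 1, so β_i decreases to n−1 exponentially fast. -/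
theorem sub_div_two_mul_sub_eq {b m : ℝ} (h : b - m / 2 ≠ 0) :
    1 - m / (2 * b - m) = (b - m) / (b - m / 2) := by
  have h' : 2 * b - m ≠ 0 := fun h0 => h (by linarith)
  rw [show b - m / 2 = (2 * b - m) / 2 by ring]
  field_simp
  ring

theorem statement18 (n : ℕ) (hn : 3 ≤ n) (β : ℕ → ℝ)
    (hβ1 : β 1 = n)
    (hrec : ∀ i, 2 ≤ i → β i = n - ((n : ℝ) - 1) / (2 * β (i - 1) - n + 1)) :
    -- the recursion for `β_i − (n−1)`
    (∀ i, 2 ≤ i →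
      β i - ((n : ℝ) - 1) = (β (i - 1) - ((n : ℝ) - 1)) / (β (i - 1) - ((n : ℝ) - 1) / 2)) ∧
    -- the case `n = 3`: `β_i = 2 + 1/i`
    (n = 3 → ∀ i, 1 ≤ i → β i = 2 + 1 / (i : ℝ)) ∧
    -- the case `n ≥ 4`: exponentially fast decrease to `n − 1`
    (4 ≤ n → ∀ i, 1 ≤ i → β i - ((n : ℝ) - 1) ≤ (2 / 3 : ℝ) ^ (i - 1)) := by
  have hn' : (3 : ℝ) ≤ n := by exact_mod_cast hn
  have step : ∀ i, 1 ≤ i → 0 < β i - ((n : ℝ) - 1) →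
      β (i + 1) - ((n : ℝ) - 1) = (β i - ((n : ℝ) - 1)) / (β i - ((n : ℝ) - 1) / 2) := by
    intro i hi hpos
    have hne : β i - ((n : ℝ) - 1) / 2 ≠ 0 := by linarith
    rw [← sub_div_two_mul_sub_eq hne, hrec (i + 1) (by omega), Nat.add_sub_cancel,
      show 2 * β i - ((n : ℝ) - 1) = 2 * β i - n + 1 by ring]
    ring
  have pos : ∀ i, 1 ≤ i → 0 < β i - ((n : ℝ) - 1) := by
    intro i hi
    induction i, hi using Nat.le_induction with
    | base => rw [hβ1]; linarith
    | succ i hi ih =>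
      rw [step i hi ih]
      exact div_pos ih (by linarith)
  refine ⟨fun i hi => ?_, fun h3 i hi => ?_, fun h4 i hi => ?_⟩
  · obtain ⟨j, rfl⟩ : ∃ j, i = j + 1 := ⟨i - 1, by omega⟩
    exact step j (by omega) (pos j (by omega))
  · subst h3
    induction i, hi using Nat.le_induction with
    | base => rw [hβ1]; norm_num
    | succ i hi ih =>
      have hi0 : (0 : ℝ) < i := by exact_mod_cast hi
      have h := step i hi (pos i hi)
      rw [ih] at h
      have hquot : (2 + 1 / (i : ℝ) - (((3 : ℕ) : ℝ) - 1)) /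
          (2 + 1 / (i : ℝ) - (((3 : ℕ) : ℝ) - 1) / 2) = 1 / ((i : ℝ) + 1) := by
        have hden : 2 + 1 / (i : ℝ) - (((3 : ℕ) : ℝ) - 1) / 2 = ((i : ℝ) + 1) / i := by
          push_cast
          field_simp
          ring
        rw [hden]
        push_cast
        field_simp
        ring
      rw [hquot] at h
      push_cast at h ⊢
      linarith
  · have h4' : (4 : ℝ) ≤ n := by exact_mod_cast h4
    induction i, hi using Nat.le_induction with
    | base => rw [hβ1]; norm_num
    | succ i hi ih =>
      have hpos := pos i hi
      obtain ⟨j, rfl⟩ : ∃ j, i = j + 1 := ⟨i - 1, by omega⟩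
      rw [step (j + 1) hi hpos, div_le_iff₀ (by linarith)]
      simp only [Nat.add_sub_cancel] at ih ⊢
      have hpow : (0 : ℝ) < (2 / 3) ^ (j + 1) := by positivity
      calc β (j + 1) - ((n : ℝ) - 1) ≤ (2 / 3) ^ (j + 1) * (3 / 2) := by
            rw [pow_succ]; linarith
        _ ≤ _ := by gcongr; linarith
end
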